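/- arXiv:1512.02600 — 2 statements merged into one kernel-verified Lean document; each statement's English description precedes it below -/
import Mathlib

section
/- Let u ∈ N^{1,1}(X) (understood as defined pointwise everywhere). Then u is continuous with respect to the 1-fine topology at 1-quasi every x ∈ X, i.e. there is a set N with cap₁(N) = 0 such that for every x ∈ X∖N and every ε > 0 there exists a 1-finely open set U containing x with |u(y) − u(x)| < ε for all y ∈ U. -/
open MeasureTheory Metric Set Filter Topology ENNReal NNReal

noncomputable section

namespace FineBV

variable {X : Type*} [MetricSpace X] [MeasurableSpace X]

/-- `g` is an upper gradient of `u` on `Ω`: for every `1`-Lipschitz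
(arclength-parametrized) curve `γ : [0, ℓ] → X` with image in `Ω`,
`|u (γ ℓ) - u (γ 0)| ≤ ∫_0^ℓ g (γ t) dt`. -/
def IsUpperGradientOn (g : X → ℝ≥0∞) (u : X → ℝ) (Ω : Set X) : Prop :=
  Measurable g ∧
    ∀ (ℓ : ℝ), 0 ≤ ℓ → ∀ γ : ℝ → X, LipschitzOnWith 1 γ (Icc 0 ℓ) →
      (∀ t ∈ Icc (0:ℝ) ℓ, γ t ∈ Ω) →
      ENNReal.ofReal |u (γ ℓ) - u (γ 0)| ≤ ∫⁻ t in Icc (0:ℝ) ℓ, g (γ t)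

/-- `g` is an upper gradient of `u` on all of `X`. -/
def IsUpperGradient (g : X → ℝ≥0∞) (u : X → ℝ) : Prop :=
  IsUpperGradientOn g u univ

/-- The (extended) `L¹` norm. -/
def eL1Norm (μ : Measure X) (u : X → ℝ) : ℝ≥0∞ :=
  ∫⁻ x, ENNReal.ofReal |u x| ∂μ

/-- The (extended) Newtonian `N^{1,1}` norm. -/
def eN11Norm (μ : Measure X) (u : X → ℝ) : ℝ≥0∞ :=
  eL1Norm μ u + ⨅ (g : X → ℝ≥0∞) (_ : IsUpperGradient g u), ∫⁻ x, g x ∂μ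

/-- Membership in the Newtonian space `N^{1,1}(X)`. -/
def MemN11 (μ : Measure X) (u : X → ℝ) : Prop :=
  Measurable u ∧ eN11Norm μ u < ⊤

/-- The `1`-capacity of a set. -/
def capacity1 (μ : Measure X) (A : Set X) : ℝ≥0∞ :=
  ⨅ (u : X → ℝ) (_ : MemN11 μ u) (_ : ∀ x ∈ A, 1 ≤ u x), eN11Norm μ u

/-- The relative (variational) `1`-capacity of `A` with respect to `Ω`. -/
def relCapacity1 (μ : Measure X) (A Ω : Set X) : ℝ≥0∞ :=
  ⨅ (u : X → ℝ) (_ : MemN11 μ u) (g : X → ℝ≥0∞) (_ : IsUpperGradient g u)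
    (_ : ∀ x ∈ A, 1 ≤ u x) (_ : ∀ x, x ∉ Ω → u x = 0),
    ∫⁻ x in Ω, g x ∂μ

/-- `A` is `1`-thin at `x`. -/
def OneThinAt (μ : Measure X) (A : Set X) (x : X) : Prop :=
  Tendsto (fun r : ℝ =>
      ENNReal.ofReal r * relCapacity1 μ (A ∩ ball x r) (ball x (2 * r)) / μ (ball x r))
    (𝓝[>] 0) (𝓝 0)

/-- `U` is `1`-finely open. -/
def OneFinelyOpen (μ : Measure X) (U : Set X) : Prop :=
  ∀ x ∈ U, OneThinAt μ Uᶜ x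

/-- `F` is `1`-finely closed. -/
def OneFinelyClosed (μ : Measure X) (F : Set X) : Prop :=
  OneFinelyOpen μ Fᶜ

/-- The `1`-fine closure: the smallest `1`-finely closed set containing `G`. -/
def oneFineClosure (μ : Measure X) (G : Set X) : Set X :=
  ⋂₀ {F : Set X | G ⊆ F ∧ OneFinelyClosed μ F}

/-- `μ` is doubling with constant `Cd`: balls have positive finite measure and
`μ(B(x,2r)) ≤ Cd · μ(B(x,r))`. -/
def DoublingWith (μ : Measure X) (Cd : ℝ≥0) : Prop :=
  ∀ (x : X) (r : ℝ), 0 < r →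
    0 < μ (ball x r) ∧ μ (ball x (2 * r)) ≤ (Cd : ℝ≥0∞) * μ (ball x r) ∧ μ (ball x r) < ⊤

/-- `u` is Lipschitz on compact subsets of `Ω` (locally Lipschitz in `Ω`). -/
def LocLipschitzOn (u : X → ℝ) (Ω : Set X) : Prop :=
  ∀ K : Set X, K ⊆ Ω → IsCompact K → ∃ L : ℝ≥0, LipschitzOnWith L u K

/-- The total variation `‖Du‖(Ω)`. -/
def totalVariation (μ : Measure X) (u : X → ℝ) (Ω : Set X) : ℝ≥0∞ :=
  ⨅ (v : ℕ → X → ℝ) (g : ℕ → X → ℝ≥0∞)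
    (_ : ∀ i, LocLipschitzOn (v i) Ω)
    (_ : ∀ i, IsUpperGradientOn (g i) (v i) Ω)
    (_ : ∀ K : Set X, K ⊆ Ω → IsCompact K →
        Tendsto (fun i => ∫⁻ x in K, ENNReal.ofReal |v i x - u x| ∂μ) atTop (𝓝 0)),
    Filter.atTop.liminf fun i => ∫⁻ x in Ω, g i x ∂μ

/-- The perimeter `P(E,Ω) = ‖Dχ_E‖(Ω)`. -/
def perimeter (μ : Measure X) (E Ω : Set X) : ℝ≥0∞ :=
  totalVariation μ (Set.indicator E fun _ => (1 : ℝ)) Ω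

/-- `u ∈ BV(X)`. -/
def MemBV (μ : Measure X) (u : X → ℝ) : Prop :=
  Integrable u μ ∧ totalVariation μ u univ < ⊤

/-- The (extended) `BV` norm. -/
def eBVNorm (μ : Measure X) (u : X → ℝ) : ℝ≥0∞ :=
  eL1Norm μ u + totalVariation μ u univ

/-- The `(1,1)`-Poincaré inequality with constants `CP`, `lam`. -/
def PoincareIneq (μ : Measure X) (CP lam : ℝ) : Prop :=
  ∀ (x : X) (r : ℝ), 0 < r → ∀ (u : X → ℝ) (g : X → ℝ≥0∞),
    LocallyIntegrable u μ → IsUpperGradient g u →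
    (∫⁻ y in ball x r, ENNReal.ofReal |u y - ⨍ z in ball x r, u z ∂μ| ∂μ) / μ (ball x r)
      ≤ ENNReal.ofReal (CP * r) * ((∫⁻ y in ball x (lam * r), g y ∂μ) / μ (ball x (lam * r)))

/-- The restricted spherical Hausdorff content of codimension 1, at scale `R`. -/
def codimHContent (μ : Measure X) (R : ℝ) (A : Set X) : ℝ≥0∞ :=
  ⨅ (c : ℕ → X) (r : ℕ → ℝ) (_ : ∀ i, 0 < r i ∧ r i ≤ R)
    (_ : A ⊆ ⋃ i, ball (c i) (r i)),
    ∑' i, μ (ball (c i) (r i)) / ENNReal.ofReal (r i)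

/-- The codimension 1 Hausdorff measure `H(A) = lim_{R→0⁺} H_R(A)`. -/
def codimH (μ : Measure X) (A : Set X) : ℝ≥0∞ :=
  ⨆ (R : ℝ) (_ : 0 < R), codimHContent μ R A

/-- The measure-theoretic interior `I_E`. -/
def measInterior (μ : Measure X) (E : Set X) : Set X :=
  {x | Tendsto (fun r : ℝ => μ (ball x r \ E) / μ (ball x r)) (𝓝[>] 0) (𝓝 0)}

/-- The measure-theoretic boundary `∂*E`. -/
def measBoundary (μ : Measure X) (E : Set X) : Set X :=
  {x | 0 < limsup (fun r : ℝ => μ (ball x r ∩ E) / μ (ball x r)) (𝓝[>] 0) ∧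
       0 < limsup (fun r : ℝ => μ (ball x r \ E) / μ (ball x r)) (𝓝[>] 0)}

/-- The lower approximate limit `u^∧`. -/
def lowerApprox (μ : Measure X) (u : X → ℝ) (x : X) : EReal :=
  sSup {t : EReal |
    Tendsto (fun r : ℝ => μ (ball x r ∩ {y | (u y : EReal) < t}) / μ (ball x r))
      (𝓝[>] 0) (𝓝 0)}

/-- The upper approximate limit `u^∨`. -/
def upperApprox (μ : Measure X) (u : X → ℝ) (x : X) : EReal :=
  sInf {t : EReal |
    Tendsto (fun r : ℝ => μ (ball x r ∩ {y | t < (u y : EReal)}) / μ (ball x r))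
      (𝓝[>] 0) (𝓝 0)}

/-- The next jump value after the value `p` at `x`. -/
def jumpNext (μ : Measure X) (u : X → ℝ) (p : EReal) (x : X) : EReal :=
  sSup {t : EReal | ∀ δ : ℝ, 0 < δ →
    Tendsto (fun r : ℝ =>
        μ (ball x r ∩ {y | p + (δ : EReal) < (u y : EReal) ∧ (u y : EReal) < t}) /
          μ (ball x r))
      (𝓝[>] 0) (𝓝 0)}

/-- Auxiliary jump values: `jumpAux μ u (l-1)` is the `l`-th jump value for `l < n`. -/
def jumpAux (μ : Measure X) (u : X → ℝ) : ℕ → X → EReal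
  | 0 => lowerApprox μ u
  | (l + 1) => fun x =>
      if jumpAux μ u l x < upperApprox μ u x then jumpNext μ u (jumpAux μ u l x) x
      else upperApprox μ u x

/-- The jump values `u^l`, `l = 1, …, n`, with `u^1 = u^∧` and `u^n = u^∨`. -/
def jumpVal (μ : Measure X) (u : X → ℝ) (n l : ℕ) : X → EReal :=
  if l = n then upperApprox μ u else jumpAux μ u (l - 1)

/-- The extended absolute difference `|a - b|` of two extended reals, with the
convention that it is `∞` whenever exactly one of them is infinite or they are
distinct infinities, and `0` when `a = b`. -/
def eAbsDiff (a b : EReal) : ℝ≥0∞ :=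
  if a = b then 0
  else if a = ⊤ ∨ a = ⊥ ∨ b = ⊤ ∨ b = ⊥ then ⊤
  else ENNReal.ofReal |a.toReal - b.toReal|

/-- `γ` satisfies the density-bound property: for every set of finite perimeter `E`,
`H`-a.e. point of `∂*E` has lower density `≥ γ` and upper density `≤ 1 - γ`. -/
def GammaDensityProperty (μ : Measure X) (γ : ℝ) : Prop :=
  ∀ E : Set X, MeasurableSet E → perimeter μ E univ < ⊤ →
    codimH μ {x ∈ measBoundary μ E |
      ¬ (ENNReal.ofReal γ ≤
            Filter.liminf (fun r : ℝ => μ (ball x r ∩ E) / μ (ball x r)) (𝓝[>] 0) ∧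
          Filter.limsup (fun r : ℝ => μ (ball x r ∩ E) / μ (ball x r)) (𝓝[>] 0) ≤
            ENNReal.ofReal (1 - γ))} = 0

/-- `v` is a discrete convolution of `u` at scale `R` (with dilation parameter `lam`). -/
def IsDiscreteConvolution (μ : Measure X) (lam R : ℝ) (u v : X → ℝ) : Prop :=
  ∃ (c : ℕ → X) (φ : ℕ → X → ℝ),
    (∀ z : X, ∃ j, z ∈ ball (c j) R) ∧
    (∃ C₀ : ℕ, ∀ k : ℕ,
      {j : ℕ | (ball (c j) (10 * lam * R) ∩ ball (c k) (10 * lam * R)).Nonempty}.Finite ∧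
      {j : ℕ | (ball (c j) (10 * lam * R) ∩ ball (c k) (10 * lam * R)).Nonempty}.ncard ≤ C₀) ∧
    (∀ j z, 0 ≤ φ j z ∧ φ j z ≤ 1) ∧
    (∃ L : ℝ≥0, ∀ j, LipschitzWith (L * (Real.toNNReal R)⁻¹) (φ j)) ∧
    (∀ j, tsupport (φ j) ⊆ ball (c j) (2 * R)) ∧
    (∀ z : X, HasSum (fun j => φ j z) 1) ∧
    (∀ z : X, v z = ∑' j, (⨍ y in ball (c j) (5 * R), u y ∂μ) * φ j z)

section UpperGradient

lemma isUpperGradient_zero : IsUpperGradient (fun _ : X => 0) (fun _ : X => (0 : ℝ)) := by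
  refine ⟨measurable_const, fun ℓ _ γ _ _ => by simp⟩

/-- A function whose increments are controlled by those of `u₁`, `u₂` and the distance has the
corresponding combination of upper gradients as an upper gradient. -/
lemma IsUpperGradient.comb {g₁ g₂ : X → ℝ≥0∞} {u₁ u₂ f : X → ℝ} (h₁ : IsUpperGradient g₁ u₁)
    (h₂ : IsUpperGradient g₂ u₂) (K₁ K₂ L : ℝ≥0)
    (hf : ∀ a b, |f a - f b| ≤ K₁ * |u₁ a - u₁ b| + K₂ * |u₂ a - u₂ b| + L * dist a b) :
    IsUpperGradient (fun x => K₁ * g₁ x + K₂ * g₂ x + L) f := by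
  refine ⟨((h₁.1.const_mul _).add (h₂.1.const_mul _)).add_const _, fun ℓ hℓ γ hγ hΩ => ?_⟩
  have e₁ := h₁.2 ℓ hℓ γ hγ hΩ
  have e₂ := h₂.2 ℓ hℓ γ hγ hΩ
  have hd : dist (γ ℓ) (γ 0) ≤ ℓ := by
    have := hγ.dist_le_mul ℓ ⟨hℓ, le_rfl⟩ 0 ⟨le_rfl, hℓ⟩
    simpa [Real.dist_eq, abs_of_nonneg hℓ] using this
  calc ENNReal.ofReal |f (γ ℓ) - f (γ 0)|
      ≤ ENNReal.ofReal (K₁ * |u₁ (γ ℓ) - u₁ (γ 0)| + K₂ * |u₂ (γ ℓ) - u₂ (γ 0)| + L * ℓ) := by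
        apply ENNReal.ofReal_le_ofReal
        refine (hf _ _).trans ?_
        gcongr
    _ = K₁ * ENNReal.ofReal |u₁ (γ ℓ) - u₁ (γ 0)| + K₂ * ENNReal.ofReal |u₂ (γ ℓ) - u₂ (γ 0)|
          + L * ENNReal.ofReal ℓ := by
        rw [ENNReal.ofReal_add (by positivity) (by positivity),
          ENNReal.ofReal_add (by positivity) (by positivity),
          ENNReal.ofReal_mul (by positivity), ENNReal.ofReal_mul (by positivity),
          ENNReal.ofReal_mul (by positivity)]
        simp
    _ ≤ K₁ * (∫⁻ t in Icc (0:ℝ) ℓ, g₁ (γ t)) + K₂ * (∫⁻ t in Icc (0:ℝ) ℓ, g₂ (γ t))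
          + ∫⁻ t in Icc (0:ℝ) ℓ, (L : ℝ≥0∞) := by
        gcongr
        simp
    _ = (∫⁻ t in Icc (0:ℝ) ℓ, K₁ * g₁ (γ t)) + (∫⁻ t in Icc (0:ℝ) ℓ, K₂ * g₂ (γ t))
          + ∫⁻ t in Icc (0:ℝ) ℓ, (L : ℝ≥0∞) := by
        rw [lintegral_const_mul' _ _ (by simp), lintegral_const_mul' _ _ (by simp)]
    _ ≤ _ := (add_le_add_left (le_lintegral_add _ _) _).trans (le_lintegral_add _ _)

/-- Increments along a subcurve. -/
lemma IsUpperGradient.subcurve {k : X → ℝ≥0∞} {f : X → ℝ} (hk : IsUpperGradient k f)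
    {ℓ : ℝ} {γ : ℝ → X} (hγ : LipschitzOnWith 1 γ (Icc 0 ℓ)) {s t : ℝ} (hs : 0 ≤ s)
    (hst : s ≤ t) (ht : t ≤ ℓ) :
    ENNReal.ofReal |f (γ t) - f (γ s)| ≤ ∫⁻ x in Icc s t, k (γ x) := by
  have hm : ∀ x ∈ Icc (0:ℝ) (t - s), s + x ∈ Icc (0:ℝ) ℓ := fun x hx =>
    ⟨by linarith [hx.1], by linarith [hx.2]⟩
  have := hk.2 (t - s) (by linarith) (fun x => γ (s + x)) (by
    intro x hx y hy
    have := hγ (hm x hx) (hm y hy)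
    simpa using this) (fun _ _ => mem_univ _)
  have e : ∫⁻ x in Icc (0:ℝ) (t - s), k (γ (s + x)) = ∫⁻ x in Icc s t, k (γ x) := by
    have h1 := (measurePreserving_add_left (volume : Measure ℝ) s).setLIntegral_comp_preimage_emb
      (MeasurableEquiv.addLeft s).measurableEmbedding (fun x => k (γ x)) (Icc s t)
    rw [← h1]
    congr 2
    simp
  rw [e] at this
  simpa using this

/-- An upper gradient may be reduced on the zero set of the function, as long as infinite path
integrals are preserved. -/
lemma IsUpperGradient.of_le_on_support {k h : X → ℝ≥0∞} {f : X → ℝ} (hk : IsUpperGradient k f)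
    (hh : Measurable h) (K L : ℝ≥0) (hkh : ∀ x, k x ≤ K * h x + L)
    (hs : ∀ x, f x ≠ 0 → k x ≤ h x) : IsUpperGradient h f := by
  refine ⟨hh, fun ℓ hℓ γ hγ _ => ?_⟩
  by_cases htop : ∫⁻ t in Icc (0:ℝ) ℓ, h (γ t) = ⊤
  · simp [htop]
  have hkfin : ∫⁻ t in Icc (0:ℝ) ℓ, k (γ t) ≠ ⊤ := by
    refine ne_top_of_le_ne_top ?_ (lintegral_mono fun t => hkh (γ t))
    rw [lintegral_add_right _ measurable_const, lintegral_const_mul' _ _ (by simp)]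
    refine ENNReal.add_ne_top.2 ⟨ENNReal.mul_ne_top (by simp) htop, ?_⟩
    simp [ENNReal.mul_eq_top]
  have hsub : ∀ s t, 0 ≤ s → s ≤ t → t ≤ ℓ →
      ENNReal.ofReal |f (γ t) - f (γ s)| ≤ ∫⁻ x in Icc s t, k (γ x) :=
    fun s t h1 h2 h3 => hk.subcurve hγ h1 h2 h3
  have hcont : ContinuousOn (fun t => f (γ t)) (Icc 0 ℓ) := by
    rw [Metric.continuousOn_iff]
    intro b hb ε hε
    obtain ⟨δ, hδ, H⟩ := exists_pos_setLIntegral_lt_of_measure_lt hkfin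
      (ε := ENNReal.ofReal ε) (by simpa using hε)
    have key : ∀ s t, 0 ≤ s → s ≤ t → t ≤ ℓ → ENNReal.ofReal (t - s) < δ →
        |f (γ t) - f (γ s)| < ε := by
      intro s t h1 h2 h3 h4
      have h5 := H (Icc s t) (lt_of_le_of_lt (Measure.restrict_apply_le _ _) (by simpa using h4))
      rw [Measure.restrict_restrict measurableSet_Icc,
        inter_eq_left.2 (Icc_subset_Icc h1 h3)] at h5
      exact (ENNReal.ofReal_lt_ofReal_iff hε).1 ((hsub s t h1 h2 h3).trans_lt h5)
    obtain ⟨η, hη, hηδ⟩ : ∃ η : ℝ, 0 < η ∧ ENNReal.ofReal η ≤ δ := by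
      by_cases hd : δ = ⊤
      · exact ⟨1, one_pos, by simp [hd]⟩
      · exact ⟨δ.toReal, ENNReal.toReal_pos hδ.ne' hd, by rw [ENNReal.ofReal_toReal hd]⟩
    refine ⟨η, hη, fun a ha hab => ?_⟩
    rw [Real.dist_eq] at hab ⊢
    rcases le_total a b with hle | hle
    · rw [abs_sub_comm]
      refine key a b ha.1 hle hb.2 (lt_of_lt_of_le ?_ hηδ)
      rw [ENNReal.ofReal_lt_ofReal_iff hη]
      rw [abs_sub_comm] at hab
      exact (le_abs_self _).trans_lt hab
    · refine key b a hb.1 hle ha.2 (lt_of_lt_of_le ?_ hηδ)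
      rw [ENNReal.ofReal_lt_ofReal_iff hη]
      exact (le_abs_self _).trans_lt hab
  by_cases hZ : ∃ t ∈ Icc (0:ℝ) ℓ, f (γ t) = 0
  · set Z := Icc (0:ℝ) ℓ ∩ (fun t => f (γ t)) ⁻¹' {0} with hZdef
    have hZc : IsCompact Z := isCompact_Icc.of_isClosed_subset
      (hcont.preimage_isClosed_of_isClosed isClosed_Icc isClosed_singleton) inter_subset_left
    have hZn : Z.Nonempty := hZ
    obtain ⟨a, haZ, ha⟩ := hZc.exists_isLeast hZn
    obtain ⟨b, hbZ, hb⟩ := hZc.exists_isGreatest hZn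
    have hab : a ≤ b := ha hbZ
    have e1 : ENNReal.ofReal |f (γ 0)| ≤ ∫⁻ x in Ico 0 a, h (γ x) := by
      have := hsub 0 a le_rfl haZ.1.1 haZ.1.2
      rw [show f (γ a) = 0 from haZ.2, zero_sub, abs_neg] at this
      refine this.trans ?_
      rw [setLIntegral_congr Ico_ae_eq_Icc.symm]
      refine setLIntegral_mono' measurableSet_Ico fun x hx => hs _ fun h0 => ?_
      exact absurd (ha ⟨⟨hx.1, hx.2.le.trans haZ.1.2⟩, h0⟩) (not_le.2 hx.2)
    have e2 : ENNReal.ofReal |f (γ ℓ)| ≤ ∫⁻ x in Ioc b ℓ, h (γ x) := by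
      have := hsub b ℓ hbZ.1.1 hbZ.1.2 le_rfl
      rw [show f (γ b) = 0 from hbZ.2, sub_zero] at this
      refine this.trans ?_
      rw [setLIntegral_congr Ioc_ae_eq_Icc.symm]
      refine setLIntegral_mono' measurableSet_Ioc fun x hx => hs _ fun h0 => ?_
      exact absurd (hb ⟨⟨hbZ.1.1.trans hx.1.le, hx.2⟩, h0⟩) (not_le.2 hx.1)
    calc ENNReal.ofReal |f (γ ℓ) - f (γ 0)|
        ≤ ENNReal.ofReal (|f (γ 0)| + |f (γ ℓ)|) :=
          ENNReal.ofReal_le_ofReal (by rw [add_comm]; exact abs_sub _ _)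
      _ = ENNReal.ofReal |f (γ 0)| + ENNReal.ofReal |f (γ ℓ)| :=
          ENNReal.ofReal_add (abs_nonneg _) (abs_nonneg _)
      _ ≤ _ := add_le_add e1 e2
      _ = ∫⁻ x in Ico 0 a ∪ Ioc b ℓ, h (γ x) := by
          rw [lintegral_union measurableSet_Ioc]
          rw [Set.disjoint_left]
          intro x hx hx'
          linarith [hx.2, hx'.1]
      _ ≤ _ := lintegral_mono_set (by
          rintro x (hx | hx)
          · exact ⟨hx.1, hx.2.le.trans haZ.1.2⟩
          · exact ⟨hbZ.1.1.trans hx.1.le, hx.2⟩)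
  · push Not at hZ
    refine (hk.2 ℓ hℓ γ hγ fun _ _ => mem_univ _).trans ?_
    exact setLIntegral_mono' measurableSet_Icc fun x hx => hs _ (hZ x hx)

end UpperGradient

section Doubling

variable {μ : Measure X} {Cd : ℝ≥0}

lemma DoublingWith.measure_ball_pow (h : DoublingWith μ Cd) (x : X) {r : ℝ} (hr : 0 < r) (k : ℕ) :
    μ (ball x (2 ^ k * r)) ≤ (Cd : ℝ≥0∞) ^ k * μ (ball x r) := by
  induction k with
  | zero => simp
  | succ k ih =>
    calc μ (ball x (2 ^ (k + 1) * r)) = μ (ball x (2 * (2 ^ k * r))) := by rw [pow_succ]; ring_nf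
      _ ≤ Cd * μ (ball x (2 ^ k * r)) := (h x _ (by positivity)).2.1
      _ ≤ Cd * ((Cd : ℝ≥0∞) ^ k * μ (ball x r)) := by gcongr
      _ = _ := by ring

lemma DoublingWith.measure_ball_le (h : DoublingWith μ Cd) {x : X} {r s : ℝ} (hr : 0 < r) (k : ℕ)
    (hs : s ≤ 2 ^ k * r) : μ (ball x s) ≤ (Cd : ℝ≥0∞) ^ k * μ (ball x r) :=
  (measure_mono (ball_subset_ball hs)).trans (h.measure_ball_pow x hr k)

lemma DoublingWith.measure_ball_lt_top (h : DoublingWith μ Cd) (x : X) (r : ℝ) :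
    μ (ball x r) < ⊤ := by
  rcases le_or_gt r 0 with hr | hr
  · simp [ball_eq_empty.2 hr]
  · exact (h x r hr).2.2

lemma DoublingWith.isLocallyFiniteMeasure (h : DoublingWith μ Cd) : IsLocallyFiniteMeasure μ :=
  ⟨fun x => ⟨ball x 1, ball_mem_nhds x one_pos, h.measure_ball_lt_top x 1⟩⟩

lemma DoublingWith.sigmaFinite (h : DoublingWith μ Cd) : SigmaFinite μ := by
  rcases isEmpty_or_nonempty X with hX | ⟨⟨x⟩⟩
  · rw [Measure.eq_zero_of_isEmpty μ]; infer_instance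
  · exact ⟨⟨⟨fun n => ball x n, fun _ => trivial, fun n => h.measure_ball_lt_top x n,
      iUnion_ball_nat x⟩⟩⟩

lemma DoublingWith.secondCountableTopology [BorelSpace X] (h : DoublingWith μ Cd) :
    SecondCountableTopology X := by
  have := h.sigmaFinite
  refine Metric.secondCountable_of_almost_dense_set fun ε hε => ?_
  obtain ⟨s, -, hd, hc⟩ := Vitali.exists_disjoint_subfamily_covering_enlargement_closedBall
    (univ : Set X) id (fun _ => ε / 5) (ε / 5) (fun _ _ => le_rfl) 5 (by norm_num)
  refine ⟨s, ?_, fun x => ?_⟩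
  · have := Measure.countable_meas_pos_of_disjoint_iUnion (μ := μ)
      (As := fun i : s => closedBall (i : X) (ε / 5)) (fun _ => isClosed_closedBall.measurableSet)
      (fun i j hij => hd i.2 j.2 (Subtype.coe_injective.ne hij))
    have hall : {i : s | 0 < μ (closedBall (i : X) (ε / 5))} = univ := by
      refine eq_univ_of_forall fun i => ?_
      exact (h i _ (by positivity)).1.trans_le (measure_mono ball_subset_closedBall)
    rw [hall] at this
    exact countable_coe_iff.1 (countable_univ_iff.1 this)
  · obtain ⟨b, hb, hsub⟩ := hc x (mem_univ _)
    refine ⟨b, hb, ?_⟩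
    have := hsub (mem_closedBall_self (by positivity))
    simp only [id, mem_closedBall] at this
    linarith

lemma DoublingWith.isUnifLocDoublingMeasure (h : DoublingWith μ Cd) :
    IsUnifLocDoublingMeasure μ := by
  refine ⟨Cd ^ 2, ?_⟩
  filter_upwards [self_mem_nhdsWithin] with ε hε x
  have hε : 0 < ε := hε
  calc μ (closedBall x (2 * ε)) ≤ μ (ball x (2 ^ 2 * ε)) :=
        measure_mono (closedBall_subset_ball (by linarith))
    _ ≤ (Cd : ℝ≥0∞) ^ 2 * μ (ball x ε) := h.measure_ball_pow x hε 2
    _ ≤ _ := by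
      push_cast
      gcongr
      exact ball_subset_closedBall

/-- A bounded measurable function is locally integrable. -/
lemma DoublingWith.locallyIntegrable (h : DoublingWith μ Cd) {u : X → ℝ} (hu : Measurable u)
    (M : ℝ) (hM : ∀ x, |u x| ≤ M) : LocallyIntegrable u μ := fun x =>
  ⟨ball x 1, ball_mem_nhds x one_pos,
    Measure.integrableOn_of_bounded (M := M) (h.measure_ball_lt_top x 1).ne
      hu.aestronglyMeasurable (Eventually.of_forall hM)⟩

/-- The `5r`-covering theorem: a countable disjoint family of balls whose enlargements cover. -/
lemma DoublingWith.exists_disjoint_cover [BorelSpace X] (h : DoublingWith μ Cd) (A : Set X)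
    (r : X → ℝ) (R : ℝ) (hr : ∀ x ∈ A, 0 < r x ∧ r x ≤ R) :
    ∃ s ⊆ A, s.Countable ∧ (s.PairwiseDisjoint fun x => ball x (r x)) ∧
      A ⊆ ⋃ x ∈ s, ball x (8 * r x) := by
  have := h.secondCountableTopology
  obtain ⟨s, hsA, hd, hc⟩ := Vitali.exists_disjoint_subfamily_covering_enlargement_closedBall
    A id r R (fun x hx => (hr x hx).2) 5 (by norm_num)
  have hd' : s.PairwiseDisjoint fun x => ball x (r x) :=
    hd.mono fun x => ball_subset_closedBall
  refine ⟨s, hsA, hd'.countable_of_isOpen (fun _ _ => isOpen_ball)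
    (fun x hx => nonempty_ball.2 (hr x (hsA hx)).1), hd', fun x hx => ?_⟩
  obtain ⟨b, hb, hsub⟩ := hc x hx
  refine mem_iUnion₂.2 ⟨b, hb, ?_⟩
  exact closedBall_subset_ball (by have := (hr b (hsA hb)).1; linarith)
    (hsub (mem_closedBall_self (hr x hx).1.le))

/-- Disjoint balls: the integrals add up to at most the full integral. -/
lemma tsum_setLIntegral_ball_le [BorelSpace X] (f : X → ℝ≥0∞) {s : Set X} (hs : s.Countable)
    (r : X → ℝ) (hd : s.PairwiseDisjoint fun x => ball x (r x)) :
    ∑' x : s, ∫⁻ y in ball (x : X) (r x), f y ∂μ ≤ ∫⁻ y, f y ∂μ := by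
  have := hs.to_subtype
  rw [← lintegral_iUnion (s := fun x : s => ball (x : X) (r x)) (fun _ => measurableSet_ball)
    (fun i j hij => hd i.2 j.2 (Subtype.coe_injective.ne hij))]
  exact setLIntegral_le_lintegral _ _

/-- Covering estimate behind weak type bounds for maximal functions. -/
lemma DoublingWith.measure_le_of_forall_ball [BorelSpace X] (h : DoublingWith μ Cd) (A : Set X)
    (f : X → ℝ≥0∞) (R : ℝ) (t : ℝ≥0∞)
    (hA : ∀ x ∈ A, ∃ r, 0 < r ∧ r ≤ R ∧ t * μ (ball x r) ≤ ∫⁻ y in ball x r, f y ∂μ) :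
    t * μ A ≤ (Cd : ℝ≥0∞) ^ 3 * ∫⁻ y, f y ∂μ := by
  choose! r hr0 hrR hr using hA
  obtain ⟨s, hsA, hsc, hd, hcov⟩ := h.exists_disjoint_cover A r R fun x hx => ⟨hr0 x hx, hrR x hx⟩
  have := hsc.to_subtype
  calc t * μ A ≤ t * ∑' x : s, μ (ball (x : X) (8 * r x)) := by
        gcongr
        refine (measure_mono hcov).trans ?_
        rw [biUnion_eq_iUnion]
        exact measure_iUnion_le _
    _ = ∑' x : s, t * μ (ball (x : X) (8 * r x)) := ENNReal.tsum_mul_left.symm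
    _ ≤ ∑' x : s, (Cd : ℝ≥0∞) ^ 3 * ∫⁻ y in ball (x : X) (r x), f y ∂μ := by
        refine ENNReal.tsum_le_tsum fun x => ?_
        calc t * μ (ball (x : X) (8 * r x)) ≤ t * ((Cd : ℝ≥0∞) ^ 3 * μ (ball (x : X) (r x))) := by
              gcongr
              exact h.measure_ball_le (hr0 x (hsA x.2)) 3 (by norm_num)
          _ = (Cd : ℝ≥0∞) ^ 3 * (t * μ (ball (x : X) (r x))) := by ring
          _ ≤ _ := by gcongr; exact hr x (hsA x.2)
    _ = (Cd : ℝ≥0∞) ^ 3 * ∑' x : s, ∫⁻ y in ball (x : X) (r x), f y ∂μ := ENNReal.tsum_mul_left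
    _ ≤ _ := by gcongr; exact tsum_setLIntegral_ball_le f hsc r hd

end Doubling

section Capacity

variable {μ : Measure X} {Cd : ℝ≥0}

lemma eN11Norm_le {u : X → ℝ} {g : X → ℝ≥0∞} (hg : IsUpperGradient g u) :
    eN11Norm μ u ≤ ∫⁻ x, ENNReal.ofReal |u x| ∂μ + ∫⁻ x, g x ∂μ :=
  add_le_add le_rfl (iInf₂_le g hg)

lemma capacity1_le {A : Set X} {u : X → ℝ} {g : X → ℝ≥0∞} (hu : Measurable u)
    (hg : IsUpperGradient g u) (hA : ∀ x ∈ A, 1 ≤ u x) :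
    capacity1 μ A ≤ ∫⁻ x, ENNReal.ofReal |u x| ∂μ + ∫⁻ x, g x ∂μ := by
  by_cases htop : ∫⁻ x, ENNReal.ofReal |u x| ∂μ + ∫⁻ x, g x ∂μ = ⊤
  · simp [htop]
  have hle := eN11Norm_le (μ := μ) hg
  refine le_trans ?_ hle
  exact iInf₂_le_of_le u ⟨hu, hle.trans_lt (lt_top_iff_ne_top.2 htop)⟩ (iInf_le_of_le hA le_rfl)

lemma capacity1_mono {A B : Set X} (h : A ⊆ B) : capacity1 μ A ≤ capacity1 μ B :=
  le_iInf₂ fun u hu => le_iInf fun hB =>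
    iInf₂_le_of_le u hu (iInf_le_of_le (fun x hx => hB x (h hx)) le_rfl)

lemma exists_of_eN11Norm_lt {u : X → ℝ} {c : ℝ≥0∞} (h : eN11Norm μ u < c) :
    ∃ g, IsUpperGradient g u ∧ ∫⁻ x, ENNReal.ofReal |u x| ∂μ + ∫⁻ x, g x ∂μ < c := by
  rw [eN11Norm, eL1Norm, ← lt_tsub_iff_left] at h
  simp only [iInf_lt_iff] at h
  obtain ⟨g, hg, hlt⟩ := h
  exact ⟨g, hg, lt_tsub_iff_left.1 hlt⟩

/-- Near-optimal test functions for the capacity with values in `[0, 1]`. -/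
lemma exists_of_capacity1_lt {A : Set X} {c : ℝ≥0∞} (h : capacity1 μ A < c) :
    ∃ (u : X → ℝ) (g : X → ℝ≥0∞), Measurable u ∧ (∀ x, 0 ≤ u x) ∧ (∀ x, u x ≤ 1) ∧
      (∀ x ∈ A, u x = 1) ∧ IsUpperGradient g u ∧
      ∫⁻ x, ENNReal.ofReal (u x) ∂μ + ∫⁻ x, g x ∂μ < c := by
  simp only [capacity1, iInf_lt_iff] at h
  obtain ⟨u, hu, hA, hlt⟩ := h
  obtain ⟨g, hg, hlt⟩ := exists_of_eN11Norm_lt hlt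
  refine ⟨fun x => max 0 (min 1 (u x)), g, (hu.1.const_inf 1).const_sup 0, fun x => le_max_left _ _,
    fun x => max_le zero_le_one (min_le_left _ _), fun x hx => by simp [hA x hx], ?_,
    lt_of_le_of_lt ?_ hlt⟩
  · have := hg.comb isUpperGradient_zero 1 0 0 (f := fun x => max 0 (min 1 (u x))) (by
      intro a b
      have h1 := abs_max_sub_max_le_abs (min 1 (u a)) (min 1 (u b)) 0
      have h2 := abs_min_sub_min_le_max 1 (u a) 1 (u b)
      simp only [sub_self, abs_zero, abs_nonneg, sup_of_le_right] at h2
      rw [max_comm 0, max_comm 0]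
      simpa using h1.trans h2)
    simpa using this
  · gcongr with x
    change max 0 (min 1 (u x)) ≤ |u x|
    rcases le_total (u x) 0 with h0 | h0
    · rw [min_eq_right (h0.trans zero_le_one), max_eq_left h0]; exact abs_nonneg _
    · rw [max_eq_right (le_min zero_le_one h0)]
      exact (min_le_right _ _).trans (le_abs_self _)

/-- Countable subadditivity of the capacity. -/
lemma capacity1_iUnion_le {ι : Type*} [Countable ι] [Nonempty ι] (A : ι → Set X) :
    capacity1 μ (⋃ i, A i) ≤ ∑' i, capacity1 μ (A i) := by
  by_cases htop : ∑' i, capacity1 μ (A i) = ⊤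
  · simp [htop]
  refine ENNReal.le_of_forall_pos_le_add fun ε hε _ => ?_
  obtain ⟨δ, hδ0, hδ⟩ := ENNReal.exists_pos_sum_of_countable (ε := (ε : ℝ≥0∞))
    (by simpa using hε.ne') ι
  have hlt : ∀ i, capacity1 μ (A i) < capacity1 μ (A i) + δ i := fun i =>
    ENNReal.lt_add_right (ENNReal.ne_top_of_tsum_ne_top htop i) (by simpa using (hδ0 i).ne')
  choose u g hu h0 h1 hA hg hug using fun i => exists_of_capacity1_lt (hlt i)
  have hbdd : ∀ x, BddAbove (range fun i => u i x) := fun x =>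
    ⟨1, by rintro _ ⟨i, rfl⟩; exact h1 i x⟩
  have hnn : ∀ x, 0 ≤ ⨆ i, u i x := fun x => Real.iSup_nonneg fun i => h0 i x
  have hmeas : Measurable fun x => ⨆ i, u i x := Measurable.iSup hu
  have hUG : IsUpperGradient (fun x => ∑' i, g i x) fun x => ⨆ i, u i x := by
    refine ⟨Measurable.tsum fun i => (hg i).1, fun ℓ hℓ γ hγ hΩ => ?_⟩
    have key : ∀ i, ENNReal.ofReal |u i (γ ℓ) - u i (γ 0)| ≤
        ∫⁻ t in Icc (0:ℝ) ℓ, ∑' i, g i (γ t) := fun i =>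
      ((hg i).2 ℓ hℓ γ hγ hΩ).trans (lintegral_mono fun t => ENNReal.le_tsum i)
    by_cases hI : ∫⁻ t in Icc (0:ℝ) ℓ, ∑' i, g i (γ t) = ⊤
    · simp [hI]
    rw [ENNReal.ofReal_le_iff_le_toReal hI]
    have key' : ∀ i, |u i (γ ℓ) - u i (γ 0)| ≤
        (∫⁻ t in Icc (0:ℝ) ℓ, ∑' i, g i (γ t)).toReal := fun i =>
      (ENNReal.ofReal_le_iff_le_toReal hI).1 (key i)
    rw [abs_sub_le_iff]
    constructor
    · rw [sub_le_iff_le_add]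
      refine ciSup_le fun i => ?_
      have := (abs_sub_le_iff.1 (key' i)).1
      have := le_ciSup (hbdd (γ 0)) i
      linarith
    · rw [sub_le_iff_le_add]
      refine ciSup_le fun i => ?_
      have := (abs_sub_le_iff.1 (key' i)).2
      have := le_ciSup (hbdd (γ ℓ)) i
      linarith
  calc capacity1 μ (⋃ i, A i)
      ≤ ∫⁻ x, ENNReal.ofReal |⨆ i, u i x| ∂μ + ∫⁻ x, ∑' i, g i x ∂μ := by
        refine capacity1_le hmeas hUG fun x hx => ?_
        obtain ⟨i, hi⟩ := mem_iUnion.1 hx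
        exact (hA i x hi).ge.trans (le_ciSup (hbdd x) i)
    _ ≤ ∫⁻ x, ∑' i, ENNReal.ofReal (u i x) ∂μ + ∫⁻ x, ∑' i, g i x ∂μ := by
        gcongr with x
        rw [abs_of_nonneg (hnn x)]
        by_cases hI : ∑' i, ENNReal.ofReal (u i x) = ⊤
        · simp [hI]
        rw [ENNReal.ofReal_le_iff_le_toReal hI]
        exact ciSup_le fun i => (ENNReal.ofReal_le_iff_le_toReal hI).1
          (ENNReal.le_tsum (f := fun i => ENNReal.ofReal (u i x)) i)
    _ = ∑' i, (∫⁻ x, ENNReal.ofReal (u i x) ∂μ + ∫⁻ x, g i x ∂μ) := by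
        rw [lintegral_tsum fun i => (hu i).ennreal_ofReal.aemeasurable,
          lintegral_tsum fun i => (hg i).1.aemeasurable, ENNReal.tsum_add]
    _ ≤ ∑' i, (capacity1 μ (A i) + δ i) := ENNReal.tsum_le_tsum fun i => (hug i).le
    _ = ∑' i, capacity1 μ (A i) + ∑' i, (δ i : ℝ≥0∞) := ENNReal.tsum_add
    _ ≤ _ := by gcongr

lemma capacity1_iUnion_eq_zero {A : ℕ → Set X} (h : ∀ i, capacity1 μ (A i) = 0) :
    capacity1 μ (⋃ i, A i) = 0 :=
  le_antisymm ((capacity1_iUnion_le A).trans (by simp [h])) (by positivity)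

lemma capacity1_union_le (A B : Set X) :
    capacity1 μ (A ∪ B) ≤ capacity1 μ A + capacity1 μ B := by
  have := capacity1_iUnion_le (μ := μ) (fun b : Bool => cond b A B)
  rw [← union_eq_iUnion] at this
  simpa using this

lemma capacity1_empty : capacity1 μ (∅ : Set X) = 0 := by
  have := capacity1_le (μ := μ) (A := ∅) (u := fun _ : X => (0 : ℝ)) measurable_const
    isUpperGradient_zero (by simp)
  simpa using this

/-- The capacity of a superlevel set. -/
lemma capacity1_superlevel_le {w : X → ℝ} {h : X → ℝ≥0∞} (hw : Measurable w) (hw0 : ∀ x, 0 ≤ w x)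
    (hh : IsUpperGradient h w) :
    capacity1 μ {x | 1 ≤ w x} ≤ ∫⁻ x, ENNReal.ofReal (w x) ∂μ + ∫⁻ x, h x ∂μ := by
  have := capacity1_le (μ := μ) (A := {x | 1 ≤ w x}) hw hh fun x hx => hx
  simpa only [abs_of_nonneg (hw0 _)] using this

/-- The standard cutoff function of a ball. -/
def ballCutoff (x : X) (r : ℝ) (y : X) : ℝ := max 0 (min 1 (2 - dist y x / r))

lemma ballCutoff_nonneg (x : X) (r : ℝ) (y : X) : 0 ≤ ballCutoff x r y := le_max_left _ _

lemma ballCutoff_le_one (x : X) (r : ℝ) (y : X) : ballCutoff x r y ≤ 1 :=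
  max_le zero_le_one (min_le_left _ _)

lemma ballCutoff_eq_one {x : X} {r : ℝ} {y : X} (hr : 0 < r) (hy : y ∈ ball x r) :
    ballCutoff x r y = 1 := by
  have : dist y x / r ≤ 1 := (div_le_one hr).2 (mem_ball.1 hy).le
  rw [ballCutoff, min_eq_left (by linarith), max_eq_right zero_le_one]

lemma ballCutoff_eq_zero {x : X} {r : ℝ} {y : X} (hr : 0 < r) (hy : y ∉ ball x (2 * r)) :
    ballCutoff x r y = 0 := by
  have : 2 ≤ dist y x / r := (le_div_iff₀ hr).2 (not_lt.1 hy)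
  rw [ballCutoff, max_eq_left]
  exact (min_le_right _ _).trans (by linarith)

lemma abs_ballCutoff_sub_le (x : X) {r : ℝ} (hr : 0 < r) (a b : X) :
    |ballCutoff x r a - ballCutoff x r b| ≤ r⁻¹ * dist a b := by
  have h1 := abs_max_sub_max_le_abs (min 1 (2 - dist a x / r)) (min 1 (2 - dist b x / r)) 0
  have h2 := abs_min_sub_min_le_max 1 (2 - dist a x / r) 1 (2 - dist b x / r)
  simp only [sub_self, abs_zero, abs_nonneg, sup_of_le_right] at h2
  rw [ballCutoff, ballCutoff, max_comm 0, max_comm 0]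
  refine h1.trans (h2.trans ?_)
  have : (2 - dist a x / r) - (2 - dist b x / r) = r⁻¹ * (dist b x - dist a x) := by
    field_simp; ring
  rw [this, abs_mul, abs_of_pos (inv_pos.2 hr)]
  gcongr
  rw [dist_comm a b]
  exact abs_dist_sub_le b a x

lemma measurable_ballCutoff [BorelSpace X] (x : X) (r : ℝ) : Measurable (ballCutoff x r) := by
  unfold ballCutoff
  refine Measurable.const_sup (Measurable.const_inf ?_ 1) 0
  exact ((continuous_id.dist continuous_const).div_const r).measurable.const_sub 2

lemma capacity1_ball_le [BorelSpace X] (x : X) {r : ℝ} (hr : 0 < r) :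
    capacity1 μ (ball x r) ≤ (1 + ENNReal.ofReal r⁻¹) * μ (ball x (2 * r)) := by
  have hUG : IsUpperGradient ((ball x (2 * r)).indicator fun _ => ENNReal.ofReal r⁻¹)
      (ballCutoff x r) := by
    have hk := isUpperGradient_zero.comb isUpperGradient_zero 0 0 r⁻¹.toNNReal
      (f := ballCutoff x r) (by
        intro a b
        simpa [hr.le] using abs_ballCutoff_sub_le x hr a b)
    refine hk.of_le_on_support (measurable_const.indicator measurableSet_ball) 0 r⁻¹.toNNReal
      (by simp) fun y hy => ?_
    have : y ∈ ball x (2 * r) := by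
      by_contra h
      exact hy (ballCutoff_eq_zero hr h)
    rw [indicator_of_mem this]
    simp [ENNReal.ofReal]
  refine (capacity1_le (measurable_ballCutoff x r) hUG fun y hy =>
    (ballCutoff_eq_one hr hy).ge).trans ?_
  rw [add_mul, one_mul, lintegral_indicator_const measurableSet_ball]
  gcongr
  calc ∫⁻ y, ENNReal.ofReal |ballCutoff x r y| ∂μ
      ≤ ∫⁻ y, (ball x (2 * r)).indicator (fun _ => 1) y ∂μ := by
        refine lintegral_mono fun y => ?_
        by_cases hy : y ∈ ball x (2 * r)
        · rw [indicator_of_mem hy, abs_of_nonneg (ballCutoff_nonneg _ _ _)]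
          simpa using ballCutoff_le_one x r y
        · simp [ballCutoff_eq_zero hr hy]
    _ = _ := by rw [lintegral_indicator_const measurableSet_ball, one_mul]

/-- Boxing: a set covered by balls whose codimension one content is controlled by an integral
has controlled capacity. -/
lemma DoublingWith.exists_capacity1_le_of_forall_ball [BorelSpace X] (h : DoublingWith μ Cd)
    (lam : ℝ) (hlam : 1 ≤ lam) :
    ∃ C : ℝ≥0, ∀ (A : Set X) (f : ℕ → X → ℝ≥0∞),
      (∀ x ∈ A, ∃ r, 0 < r ∧ r ≤ 1 ∧ μ (ball x r) ≤
        ENNReal.ofReal r * liminf (fun n => ∫⁻ y in ball x (lam * r), f n y ∂μ) atTop) →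
      capacity1 μ A ≤ C * liminf (fun n => ∫⁻ y, f n y ∂μ) atTop := by
  obtain ⟨k, hk⟩ := pow_unbounded_of_one_lt (16 * lam) (one_lt_two (α := ℝ))
  refine ⟨2 * Cd ^ k, fun A f hA => ?_⟩
  choose! r hr0 hr1 hr using hA
  have hlam0 : 0 < lam := by linarith
  obtain ⟨s, hsA, hsc, hd, hcov⟩ := h.exists_disjoint_cover A (fun x => lam * r x) lam
    fun x hx => ⟨mul_pos hlam0 (hr0 x hx), by nlinarith [hr1 x hx, hr0 x hx]⟩
  rcases s.eq_empty_or_nonempty with rfl | hne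
  · have : A = ∅ := by simpa using hcov
    simp [this, capacity1_empty]
  have := hsc.to_subtype
  have := hne.to_subtype
  have hball : ∀ x : s, capacity1 μ (ball (x : X) (8 * (lam * r x))) ≤
      (2 * Cd ^ k : ℝ≥0) * liminf (fun n => ∫⁻ y in ball (x : X) (lam * r x), f n y ∂μ) atTop := by
    intro x
    have h0 := hr0 x (hsA x.2)
    have h1 := hr1 x (hsA x.2)
    have hinv : 1 ≤ (r (x : X))⁻¹ := (one_le_inv₀ h0).2 h1
    calc capacity1 μ (ball (x : X) (8 * (lam * r x)))
        ≤ (1 + ENNReal.ofReal (8 * (lam * r x))⁻¹) * μ (ball (x : X) (2 * (8 * (lam * r x)))) :=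
          capacity1_ball_le _ (by positivity)
      _ ≤ (2 * ENNReal.ofReal (r x)⁻¹) * ((Cd : ℝ≥0∞) ^ k * μ (ball (x : X) (r x))) := by
          gcongr
          · rw [two_mul]
            gcongr
            · simpa using hinv
            · nlinarith
          · refine h.measure_ball_le h0 k ?_
            nlinarith
      _ ≤ (2 * ENNReal.ofReal (r x)⁻¹) * ((Cd : ℝ≥0∞) ^ k * (ENNReal.ofReal (r x) *
            liminf (fun n => ∫⁻ y in ball (x : X) (lam * r x), f n y ∂μ) atTop)) := by
          gcongr
          exact hr x (hsA x.2)
      _ = (ENNReal.ofReal (r x)⁻¹ * ENNReal.ofReal (r x)) * (2 * (Cd : ℝ≥0∞) ^ k *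
            liminf (fun n => ∫⁻ y in ball (x : X) (lam * r x), f n y ∂μ) atTop) := by ring
      _ = _ := by
          rw [← ENNReal.ofReal_mul (by positivity), inv_mul_cancel₀ h0.ne']
          simp
  calc capacity1 μ A ≤ capacity1 μ (⋃ x : s, ball (x : X) (8 * (lam * r x))) := by
        rw [← biUnion_eq_iUnion s (fun x _ => ball x (8 * (lam * r x)))]
        exact capacity1_mono hcov
    _ ≤ ∑' x : s, capacity1 μ (ball (x : X) (8 * (lam * r x))) := capacity1_iUnion_le _
    _ ≤ ∑' x : s, (2 * Cd ^ k : ℝ≥0) *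
          liminf (fun n => ∫⁻ y in ball (x : X) (lam * r x), f n y ∂μ) atTop :=
        ENNReal.tsum_le_tsum hball
    _ = (2 * Cd ^ k : ℝ≥0) * ∑' x : s,
          liminf (fun n => ∫⁻ y in ball (x : X) (lam * r x), f n y ∂μ) atTop :=
        ENNReal.tsum_mul_left
    _ ≤ (2 * Cd ^ k : ℝ≥0) * liminf (fun n => ∫⁻ y, f n y ∂μ) atTop := by
        gcongr
        let _ : MeasurableSpace s := ⊤
        rw [← lintegral_count]
        refine (lintegral_liminf_le fun n => measurable_from_top).trans ?_
        refine liminf_le_liminf (Eventually.of_forall fun n => ?_)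
        simp only [lintegral_count]
        exact tsum_setLIntegral_ball_le (f n) hsc _ hd

end Capacity

section GradientDensity

variable {μ : Measure X} {Cd : ℝ≥0}

lemma tendsto_setLIntegral_superlevel {g : X → ℝ≥0∞} (hg : Measurable g)
    (hfin : ∫⁻ x, g x ∂μ ≠ ⊤) :
    Tendsto (fun K : ℕ => ∫⁻ x in {x | (K : ℝ≥0∞) < g x}, g x ∂μ) atTop (𝓝 0) := by
  refine tendsto_setLIntegral_zero hfin ?_
  have hlim : Tendsto (fun K : ℕ => (∫⁻ x, g x ∂μ) / (K : ℝ≥0∞)) atTop (𝓝 0) := by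
    have := ENNReal.Tendsto.const_div (a := ∫⁻ x, g x ∂μ) ENNReal.tendsto_nat_nhds_top
      (Or.inr hfin)
    simpa using this
  refine tendsto_of_tendsto_of_tendsto_of_le_of_le' tendsto_const_nhds hlim
    (Eventually.of_forall fun _ => by positivity) ?_
  filter_upwards [eventually_gt_atTop 0] with K hK
  have := meas_ge_le_lintegral_div (μ := μ) hg.aemeasurable (ε := (K : ℝ≥0∞))
    (Nat.cast_ne_zero.2 hK.ne') (natCast_ne_top K)
  refine le_trans (measure_mono ?_) this
  intro x hx
  simp only [mem_ofPred_eq] at hx ⊢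
  exact hx.le

/-- The integral of `g` over a set is bounded by that of its tail and a multiple of the measure. -/
lemma setLIntegral_le_tail_add (g : X → ℝ≥0∞) (K : ℝ≥0∞) (B : Set X) :
    ∫⁻ x in B, g x ∂μ ≤
      ∫⁻ x in B, {x | K < g x}.indicator g x ∂μ + K * μ B := by
  have : ∫⁻ x in B, g x ∂μ ≤ ∫⁻ x in B, ({x | K < g x}.indicator g x + K) ∂μ := by
    refine lintegral_mono fun x => ?_
    by_cases hx : K < g x
    · rw [indicator_of_mem (by exact hx)]; exact le_self_add
    · exact (not_lt.1 hx).trans le_add_self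
  refine this.trans ?_
  rw [lintegral_add_right _ measurable_const]
  simp

/-- For an integrable function the codimension one density vanishes outside a set of capacity
zero. -/
lemma DoublingWith.capacity1_not_tendsto_gradient [BorelSpace X] (h : DoublingWith μ Cd)
    {g : X → ℝ≥0∞} (hg : Measurable g) (hfin : ∫⁻ x, g x ∂μ ≠ ⊤) :
    capacity1 μ {x | ¬ Tendsto (fun r : ℝ =>
      ENNReal.ofReal r * (∫⁻ y in ball x r, g y ∂μ) / μ (ball x r)) (𝓝[>] 0) (𝓝 0)} = 0 := by
  obtain ⟨C, hC⟩ := h.exists_capacity1_le_of_forall_ball 1 le_rfl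
  let A : ℕ → Set X := fun m => {x | ∃ᶠ r in 𝓝[>] (0:ℝ), (m : ℝ≥0∞)⁻¹ <
    ENNReal.ofReal r * (∫⁻ y in ball x r, g y ∂μ) / μ (ball x r)}
  have hsub : {x | ¬ Tendsto (fun r : ℝ =>
      ENNReal.ofReal r * (∫⁻ y in ball x r, g y ∂μ) / μ (ball x r)) (𝓝[>] 0) (𝓝 0)}
      ⊆ ⋃ m, A (m + 1) := by
    intro x hx
    simp only [mem_ofPred_eq, ENNReal.tendsto_nhds_zero, not_forall] at hx
    obtain ⟨ε, hε, hx⟩ := hx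
    obtain ⟨m, hm⟩ := ENNReal.exists_inv_nat_lt hε.ne'
    refine mem_iUnion.2 ⟨m, ?_⟩
    rw [not_eventually] at hx
    refine hx.mono fun r hr => lt_of_le_of_lt ?_ (not_le.1 hr)
    refine le_trans ?_ hm.le
    gcongr
    simp
  refine le_antisymm ((capacity1_mono hsub).trans (capacity1_iUnion_eq_zero fun m => ?_).le)
    (by positivity)
  set c : ℝ≥0∞ := ((m + 1 : ℕ) : ℝ≥0∞)⁻¹ with hc
  have hc0 : c ≠ 0 := by simp [hc]
  have hct : c ≠ ⊤ := by simp [hc]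
  have key : ∀ K : ℕ, capacity1 μ (A (m + 1)) ≤
      C * (2 / c * ∫⁻ x in {x | (K : ℝ≥0∞) < g x}, g x ∂μ) := by
    intro K
    have hms : MeasurableSet {x | (K : ℝ≥0∞) < g x} := measurableSet_lt measurable_const hg
    have := hC (A (m + 1)) (fun _ x => 2 / c * {x | (K : ℝ≥0∞) < g x}.indicator g x) ?_
    · rw [liminf_const, lintegral_const_mul' _ _ (ENNReal.div_ne_top (by simp) hc0),
        lintegral_indicator hms] at this
      exact this
    intro x hx
    have hev : ∀ᶠ r in 𝓝[>] (0:ℝ), 0 < r ∧ r ≤ 1 ∧ ENNReal.ofReal r * K ≤ c / 2 := by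
      have h1 : ∀ᶠ r in 𝓝[>] (0:ℝ), r ≤ 1 :=
        nhdsWithin_le_nhds (Iic_mem_nhds one_pos)
      have h2 : Tendsto (fun r : ℝ => ENNReal.ofReal r * K) (𝓝[>] 0) (𝓝 0) := by
        have h3 : Tendsto (fun r : ℝ => ENNReal.ofReal r) (𝓝[>] 0) (𝓝 0) := by
          have := (ENNReal.continuous_ofReal.tendsto 0).mono_left
            (nhdsWithin_le_nhds (s := Ioi (0:ℝ)))
          simpa using this
        have := ENNReal.Tendsto.mul_const h3 (b := (K : ℝ≥0∞)) (Or.inr (by simp))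
        simpa using this
      filter_upwards [self_mem_nhdsWithin, h1,
        (ENNReal.tendsto_nhds_zero.1 h2) (c / 2) (ENNReal.div_pos hc0 (by simp))] with r hr0 hr1 hr2
      exact ⟨hr0, hr1, hr2⟩
    obtain ⟨r, hr, hr0, hr1, hrK⟩ := ((show ∃ᶠ r in 𝓝[>] (0:ℝ), c <
      ENNReal.ofReal r * (∫⁻ y in ball x r, g y ∂μ) / μ (ball x r) from hx).and_eventually hev).exists
    refine ⟨r, hr0, hr1, ?_⟩
    have hB0 := (h x r hr0).1
    have hBt := (h x r hr0).2.2
    rw [one_mul, liminf_const, lintegral_const_mul' _ _ (ENNReal.div_ne_top (by simp) hc0)]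
    set I := ∫⁻ y in ball x r, {x | (K : ℝ≥0∞) < g x}.indicator g y ∂μ
    have e1 : c * μ (ball x r) ≤ ENNReal.ofReal r * I + c / 2 * μ (ball x r) := by
      have := (ENNReal.le_div_iff_mul_le (Or.inl hB0.ne') (Or.inl hBt.ne)).1 hr.le
      refine this.trans ?_
      calc ENNReal.ofReal r * (∫⁻ y in ball x r, g y ∂μ)
          ≤ ENNReal.ofReal r * (I + K * μ (ball x r)) := by
            gcongr; exact setLIntegral_le_tail_add g K _
        _ = ENNReal.ofReal r * I + (ENNReal.ofReal r * K) * μ (ball x r) := by ring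
        _ ≤ _ := by gcongr
    have e2 : c / 2 * μ (ball x r) ≤ ENNReal.ofReal r * I := by
      have h3 : c * μ (ball x r) = c / 2 * μ (ball x r) + c / 2 * μ (ball x r) := by
        rw [← add_mul, ENNReal.add_halves]
      rw [h3] at e1
      exact (ENNReal.add_le_add_iff_right
        (ENNReal.mul_ne_top (ENNReal.div_ne_top hct (by simp)) hBt.ne)).1 e1
    calc μ (ball x r) = 2 / c * (c / 2 * μ (ball x r)) := by
          rw [← mul_assoc, ← mul_div_assoc, ENNReal.div_mul_cancel hc0 hct,
            ENNReal.div_self (by simp) (by simp), one_mul]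
      _ ≤ 2 / c * (ENNReal.ofReal r * I) := by gcongr
      _ = _ := by ring
  have hlim : Tendsto (fun K : ℕ => C * (2 / c * ∫⁻ x in {x | (K : ℝ≥0∞) < g x}, g x ∂μ))
      atTop (𝓝 0) := by
    have h1 := ENNReal.Tendsto.const_mul (a := 2 / c) (tendsto_setLIntegral_superlevel hg hfin)
      (Or.inr (ENNReal.div_ne_top (by simp) hc0))
    have h2 := ENNReal.Tendsto.const_mul (a := (C : ℝ≥0∞)) h1 (Or.inr (by simp))
    simpa using h2
  exact le_antisymm (ge_of_tendsto' hlim key) (by positivity)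

end GradientDensity

section LevelSets

variable {μ : Measure X} {Cd : ℝ≥0}

/-- Ramp of slope `n + 1` between the levels `τ` and `τ + 1 / (n + 1)`. -/
def levelRamp (w : X → ℝ) (τ : ℝ) (n : ℕ) (x : X) : ℝ :=
  max 0 (min 1 ((n + 1) * (w x - τ)))

/-- The set where `levelRamp w τ n` takes intermediate values. -/
def levelStrip (w : X → ℝ) (τ : ℝ) (n : ℕ) : Set X :=
  {x | τ < w x ∧ w x < τ + 1 / (n + 1)}

/-- An upper gradient of `levelRamp w τ n`. -/
def levelGradient (h : X → ℝ≥0∞) (w : X → ℝ) (τ : ℝ) (n : ℕ) (x : X) : ℝ≥0∞ :=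
  ((n + 1 : ℝ≥0) : ℝ≥0∞) * (levelStrip w τ n).indicator h x + h x

lemma measurableSet_levelStrip {w : X → ℝ} (hw : Measurable w) (τ : ℝ) (n : ℕ) :
    MeasurableSet (levelStrip w τ n) :=
  (measurableSet_lt measurable_const hw).inter (measurableSet_lt hw measurable_const)

lemma measurable_levelGradient {w : X → ℝ} {h : X → ℝ≥0∞} (hw : Measurable w)
    (hh : Measurable h) (τ : ℝ) (n : ℕ) : Measurable (levelGradient h w τ n) :=
  ((hh.indicator (measurableSet_levelStrip hw τ n)).const_mul _).add hh

/-- A good level: the coarea-type averages of `h` over thin strips stay bounded. -/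
lemma exists_level [SFinite μ] {w : X → ℝ} {h : X → ℝ≥0∞} (hw : Measurable w)
    (hh : Measurable h) :
    ∃ τ ∈ Ioo (1 / 2 : ℝ) 1,
      liminf (fun n => ∫⁻ x, levelGradient h w τ n x ∂μ) atTop ≤ 3 * ∫⁻ x, h x ∂μ := by
  let F : ℕ → ℝ → X → ℝ≥0∞ := fun n τ x =>
    ((n + 1 : ℝ≥0) : ℝ≥0∞) * (levelStrip w τ n).indicator h x
  have hF : ∀ n, Measurable (Function.uncurry (F n)) := by
    intro n
    have : Function.uncurry (F n) = fun p : ℝ × X => ((n + 1 : ℝ≥0) : ℝ≥0∞) *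
        {p : ℝ × X | p.1 < w p.2 ∧ w p.2 < p.1 + 1 / (n + 1)}.indicator (fun p => h p.2) p := rfl
    rw [this]
    refine ((hh.comp measurable_snd).indicator ?_).const_mul _
    exact (measurableSet_lt measurable_fst (hw.comp measurable_snd)).inter
      (measurableSet_lt (hw.comp measurable_snd) (measurable_fst.add_const _))
  have hG : ∀ n, Measurable fun τ => ∫⁻ x, F n τ x ∂μ := fun n => (hF n).lintegral_prod_right'
  have hIle : ∀ n, ∫⁻ τ in Ioo (1 / 2 : ℝ) 1, ∫⁻ x, F n τ x ∂μ ≤ ∫⁻ x, h x ∂μ := by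
    intro n
    rw [lintegral_lintegral_swap (hF n).aemeasurable]
    refine lintegral_mono fun x => ?_
    calc ∫⁻ τ in Ioo (1 / 2 : ℝ) 1, F n τ x ≤ ∫⁻ τ, F n τ x := setLIntegral_le_lintegral _ _
      _ = ∫⁻ τ, (Ioo (w x - 1 / (n + 1)) (w x)).indicator
            (fun _ => ((n + 1 : ℝ≥0) : ℝ≥0∞) * h x) τ := by
          refine lintegral_congr fun τ => ?_
          by_cases hx : x ∈ levelStrip w τ n
          · have : τ ∈ Ioo (w x - 1 / (n + 1)) (w x) := ⟨by linarith [hx.2], hx.1⟩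
            simp only [F]
            rw [indicator_of_mem hx, indicator_of_mem this]
          · have : τ ∉ Ioo (w x - 1 / (n + 1)) (w x) := fun hτ => hx ⟨hτ.2, by linarith [hτ.1]⟩
            simp only [F]
            rw [indicator_of_notMem hx, indicator_of_notMem this, mul_zero]
      _ = ((n + 1 : ℝ≥0) : ℝ≥0∞) * h x * ENNReal.ofReal (1 / (n + 1)) := by
          rw [lintegral_indicator_const measurableSet_Ioo, Real.volume_Ioo, _root_.sub_sub_cancel]
      _ = h x := by
          rw [mul_right_comm, ← ENNReal.ofReal_coe_nnreal, ← ENNReal.ofReal_mul (by positivity)]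
          have : (((n + 1 : ℝ≥0) : ℝ) * (1 / (n + 1))) = 1 := by
            push_cast; field_simp
          rw [this, ENNReal.ofReal_one, one_mul]
  have hvol : volume (Ioo (1 / 2 : ℝ) 1) = 2⁻¹ := by
    rw [Real.volume_Ioo, show (1 - 1 / 2 : ℝ) = 2⁻¹ by norm_num, ENNReal.ofReal_inv_of_pos two_pos]
    simp
  obtain ⟨τ, hτ, hle⟩ := exists_le_setLAverage (μ := volume) (s := Ioo (1 / 2 : ℝ) 1)
    (f := fun τ => liminf (fun n => ∫⁻ x, F n τ x ∂μ) atTop) (by rw [hvol]; simp) (by rw [hvol]; simp)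
    (Measurable.liminf hG).aemeasurable
  refine ⟨τ, hτ, ?_⟩
  have h1 : ∫⁻ τ in Ioo (1 / 2 : ℝ) 1, liminf (fun n => ∫⁻ x, F n τ x ∂μ) atTop ≤
      ∫⁻ x, h x ∂μ := by
    refine (lintegral_liminf_le hG).trans ?_
    refine (liminf_le_liminf (Eventually.of_forall hIle)).trans ?_
    simp
  rw [setLAverage_eq, hvol, ENNReal.div_eq_inv_mul, inv_inv] at hle
  have h2 : liminf (fun n => ∫⁻ x, F n τ x ∂μ) atTop ≤ 2 * ∫⁻ x, h x ∂μ := by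
    refine hle.trans ?_
    gcongr
  have h3 : ∀ n, ∫⁻ x, levelGradient h w τ n x ∂μ = (∫⁻ x, F n τ x ∂μ) + ∫⁻ x, h x ∂μ :=
    fun n => lintegral_add_right _ hh
  simp only [h3]
  rw [liminf_add_const _ _ _ (by isBoundedDefault) (by isBoundedDefault)]
  calc _ ≤ 2 * ∫⁻ x, h x ∂μ + ∫⁻ x, h x ∂μ := by gcongr
    _ = _ := by ring

lemma isUpperGradient_levelGradient {w : X → ℝ} {h : X → ℝ≥0∞} (hw : Measurable w)
    (hh : IsUpperGradient h w) (τ : ℝ) (n : ℕ) :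
    IsUpperGradient (levelGradient h w τ n) (levelRamp w τ n) := by
  have hms := measurableSet_lt (measurable_const (a := τ)) hw
  have hn : (0:ℝ) < n + 1 := by positivity
  have h0 : IsUpperGradient (fun x => ((n + 1 : ℝ≥0) : ℝ≥0∞) * h x) (levelRamp w τ n) := by
    have := hh.comb isUpperGradient_zero (n + 1) 0 0 (f := levelRamp w τ n) (by
      intro a b
      have h1 := abs_max_sub_max_le_abs (min 1 ((n + 1) * (w a - τ))) (min 1 ((n + 1) * (w b - τ))) 0
      have h2 := abs_min_sub_min_le_max 1 ((n + 1) * (w a - τ)) 1 ((n + 1) * (w b - τ))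
      simp only [sub_self, abs_zero, abs_nonneg, sup_of_le_right] at h2
      rw [← mul_sub, sub_sub_sub_cancel_right, abs_mul, abs_of_pos hn] at h2
      simp only [levelRamp]
      rw [max_comm 0, max_comm 0]
      simpa using h1.trans h2)
    simpa using this
  have h1 : IsUpperGradient
      (fun x => ((n + 1 : ℝ≥0) : ℝ≥0∞) * {x | τ < w x}.indicator h x + h x) (levelRamp w τ n) := by
    refine h0.of_le_on_support (((hh.1.indicator hms).const_mul _).add hh.1) (n + 1) 0 ?_ ?_
    · intro x
      simp only [ENNReal.coe_zero, add_zero]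
      gcongr
      exact le_add_self
    · intro x hx
      have : x ∈ {x | τ < w x} := by
        by_contra hc
        refine hx (max_eq_left ((min_le_right _ _).trans ?_))
        exact mul_nonpos_of_nonneg_of_nonpos hn.le (sub_nonpos.2 (not_lt.1 hc))
      rw [indicator_of_mem this]
      exact le_self_add
  have h2 : IsUpperGradient
      (fun x => ((n + 1 : ℝ≥0) : ℝ≥0∞) * {x | τ < w x}.indicator h x + h x)
      (fun x => 1 - levelRamp w τ n x) := by
    have := h1.comb isUpperGradient_zero 1 0 0 (f := fun x => 1 - levelRamp w τ n x) (by
      intro a b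
      rw [_root_.sub_sub_sub_cancel_left, abs_sub_comm]
      simp)
    simpa using this
  have h3 : IsUpperGradient (levelGradient h w τ n) (fun x => 1 - levelRamp w τ n x) := by
    refine h2.of_le_on_support (measurable_levelGradient hw hh.1 τ n) (n + 2) 0 ?_ ?_
    · intro x
      calc ((n + 1 : ℝ≥0) : ℝ≥0∞) * {x | τ < w x}.indicator h x + h x
          ≤ ((n + 1 : ℝ≥0) : ℝ≥0∞) * h x + h x := by
            gcongr
            exact indicator_le_self _ _ x
        _ = ((n + 2 : ℝ≥0) : ℝ≥0∞) * h x + (0 : ℝ≥0) := by push_cast; ring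
        _ ≤ _ := by
            gcongr
            exact le_add_self
    · intro x hx
      have : {x | τ < w x}.indicator h x = (levelStrip w τ n).indicator h x := by
        by_cases h1 : τ < w x
        · have h2 : x ∈ levelStrip w τ n := by
            refine ⟨h1, ?_⟩
            by_contra hc
            refine hx ?_
            have : 1 ≤ (n + 1) * (w x - τ) := by
              have := not_lt.1 hc
              rw [← div_le_iff₀' hn]
              linarith
            simp [levelRamp, min_eq_left this]
          rw [indicator_of_mem (by exact h1), indicator_of_mem h2]
        · rw [indicator_of_notMem (by exact h1), indicator_of_notMem fun h2 => h1 h2.1]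
      rw [levelGradient, this]
  have := h3.comb isUpperGradient_zero 1 0 0 (f := levelRamp w τ n) (by
      intro a b
      rw [_root_.sub_sub_sub_cancel_left, abs_sub_comm]
      simp)
  simpa using this

end LevelSets

section Density

variable {μ : Measure X} {Cd : ℝ≥0} {CP lam : ℝ}

/-- Multiplicative form of the Poincaré inequality. -/
lemma PoincareIneq.lintegral_le (hPI : PoincareIneq μ CP lam) (h : DoublingWith μ Cd)
    (hlam : 1 ≤ lam) {x : X} {r : ℝ} (hr : 0 < r) {u : X → ℝ} {g : X → ℝ≥0∞}
    (hu : LocallyIntegrable u μ) (hg : IsUpperGradient g u) :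
    ∫⁻ y in ball x r, ENNReal.ofReal |u y - ⨍ z in ball x r, u z ∂μ| ∂μ ≤
      ENNReal.ofReal (CP * r) * ∫⁻ y in ball x (lam * r), g y ∂μ := by
  have := (ENNReal.div_le_iff (h x r hr).1.ne' (h x r hr).2.2.ne).1 (hPI x r hr u g hu hg)
  refine this.trans ?_
  have hsub : ball x r ⊆ ball x (lam * r) := ball_subset_ball (by nlinarith)
  calc _ ≤ ENNReal.ofReal (CP * r) * ((∫⁻ y in ball x (lam * r), g y ∂μ) /
        μ (ball x (lam * r))) * μ (ball x (lam * r)) := by gcongr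
    _ ≤ _ := by
      rw [mul_assoc, mul_comm (_ / _)]
      gcongr
      exact ENNReal.mul_div_le

lemma measure_le_two_mul_setLIntegral {S B : Set X} (hS : MeasurableSet S) (hSB : S ⊆ B)
    {f : X → ℝ} (hf : ∀ x ∈ S, 1 / 2 ≤ |f x|) :
    μ S ≤ 2 * ∫⁻ x in B, ENNReal.ofReal |f x| ∂μ := by
  calc μ S = ∫⁻ _ in S, 1 ∂μ := by simp
    _ ≤ ∫⁻ x in S, 2 * ENNReal.ofReal |f x| ∂μ := by
      refine setLIntegral_mono' hS fun x hx => ?_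
      rw [← ENNReal.ofReal_ofNat 2, ← ENNReal.ofReal_mul zero_le_two, ← ENNReal.ofReal_one]
      exact ENNReal.ofReal_le_ofReal (by linarith [hf x hx])
    _ = 2 * ∫⁻ x in S, ENNReal.ofReal |f x| ∂μ := lintegral_const_mul' _ _ (by simp)
    _ ≤ _ := by gcongr

/-- A relative isoperimetric inequality for superlevel sets. -/
lemma PoincareIneq.min_measure_le [BorelSpace X] (hPI : PoincareIneq μ CP lam)
    (h : DoublingWith μ Cd) (hlam : 1 ≤ lam) {w : X → ℝ} {g : X → ℝ≥0∞} (hw : Measurable w)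
    (hg : IsUpperGradient g w) (τ : ℝ) {x : X} {r : ℝ} (hr : 0 < r) :
    min (μ (ball x r ∩ {y | τ < w y})) (μ (ball x r ∩ {y | w y ≤ τ})) ≤
      2 * ENNReal.ofReal (CP * r) *
        liminf (fun n => ∫⁻ y in ball x (lam * r), levelGradient g w τ n y ∂μ) atTop := by
  let E : ℕ → Set X := fun n => ball x r ∩ {y | τ + 1 / (n + 1) ≤ w y}
  have hstep : ∀ n, min (μ (E n)) (μ (ball x r ∩ {y | w y ≤ τ})) ≤ 2 * ENNReal.ofReal (CP * r) *
      ∫⁻ y in ball x (lam * r), levelGradient g w τ n y ∂μ := by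
    intro n
    have hn : (0:ℝ) < n + 1 := by positivity
    have hvm : Measurable (levelRamp w τ n) :=
      (((hw.sub_const _).const_mul _).const_inf 1).const_sup 0
    have hv0 : ∀ y, 0 ≤ levelRamp w τ n y := fun y => le_max_left _ _
    have hv1 : ∀ y, levelRamp w τ n y ≤ 1 := fun y => max_le zero_le_one (min_le_left _ _)
    have hP := hPI.lintegral_le h hlam hr (h.locallyIntegrable hvm 1 fun y => by
      rw [abs_of_nonneg (hv0 y)]; exact hv1 y) (isUpperGradient_levelGradient hw hg τ n) (x := x)
    set c := ⨍ z in ball x r, levelRamp w τ n z ∂μ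
    rw [mul_assoc]
    refine le_trans ?_ (mul_le_mul_right hP 2)
    rcases le_total c (1 / 2) with hc | hc
    · refine (min_le_left _ _).trans (measure_le_two_mul_setLIntegral
        (measurableSet_ball.inter (measurableSet_le measurable_const hw)) inter_subset_left ?_)
      intro y hy
      have h1 : levelRamp w τ n y = 1 := by
        have hy2 : τ + 1 / (n + 1) ≤ w y := hy.2
        have : 1 ≤ (n + 1) * (w y - τ) := by
          rw [← div_le_iff₀' hn]
          linarith
        simp [levelRamp, min_eq_left this]
      rw [h1]
      exact le_trans (by linarith) (le_abs_self _)
    · refine (min_le_right _ _).trans (measure_le_two_mul_setLIntegral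
        (measurableSet_ball.inter (measurableSet_le hw measurable_const)) inter_subset_left ?_)
      intro y hy
      have h1 : levelRamp w τ n y = 0 := by
        have hy2 : w y ≤ τ := hy.2
        refine max_eq_left ((min_le_right _ _).trans ?_)
        exact mul_nonpos_of_nonneg_of_nonpos hn.le (sub_nonpos.2 hy2)
      rw [h1, abs_sub_comm]
      exact le_trans (by linarith) (le_abs_self _)
  have hmono : Monotone E := by
    intro m n hmn y hy
    have hy2 : τ + 1 / (m + 1) ≤ w y := hy.2
    refine ⟨hy.1, show τ + 1 / (n + 1) ≤ w y from le_trans ?_ hy2⟩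
    gcongr
  have hU : ⋃ n, E n = ball x r ∩ {y | τ < w y} := by
    ext y
    simp only [E, mem_iUnion, mem_inter_iff, mem_ofPred_eq]
    constructor
    · rintro ⟨n, hy, hn⟩
      exact ⟨hy, lt_of_lt_of_le (by linarith [Nat.one_div_pos_of_nat (α := ℝ) (n := n)]) hn⟩
    · rintro ⟨hy, hlt⟩
      obtain ⟨n, hn⟩ := exists_nat_one_div_lt (sub_pos.2 hlt)
      exact ⟨n, hy, by linarith⟩
  have hlim := (tendsto_measure_iUnion_atTop (μ := μ) hmono).min
    (tendsto_const_nhds (x := μ (ball x r ∩ {y | w y ≤ τ})))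
  rw [hU] at hlim
  rw [← hlim.liminf_eq, ← ENNReal.liminf_const_mul_of_ne_top (by finiteness)]
  exact liminf_le_liminf (Eventually.of_forall hstep)

/-- Points at which a superlevel set has large density at some scale form a set of small
capacity. -/
lemma PoincareIneq.exists_capacity1_density_le [BorelSpace X] (hPI : PoincareIneq μ CP lam)
    (h : DoublingWith μ Cd) (hCd : 1 ≤ Cd) (hlam : 1 ≤ lam) {c : ℝ≥0} (hc : 0 < c)
    (hc2 : c ≤ 1 / 2) :
    ∃ C : ℝ≥0, ∀ (w : X → ℝ) (g : X → ℝ≥0∞), Measurable w → (∀ x, 0 ≤ w x) →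
      IsUpperGradient g w →
      capacity1 μ {x | ∃ r, 0 < r ∧ r ≤ 1 ∧
        c * μ (ball x r) ≤ μ (ball x r ∩ {y | 1 ≤ w y})} ≤
        C * (∫⁻ x, ENNReal.ofReal (w x) ∂μ + ∫⁻ x, g x ∂μ) := by
  obtain ⟨C, hC⟩ := h.exists_capacity1_le_of_forall_ball lam hlam
  set D : ℝ≥0 := 2 * Cd + 2 * Cd ^ 2 * CP.toNNReal with hD
  refine ⟨C * (c⁻¹ * D) * 3, fun w g hw hw0 hg => ?_⟩
  have := h.sigmaFinite
  obtain ⟨τ, hτ, hlev⟩ := exists_level (μ := μ) hw hg.1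
  set E : Set X := {y | τ < w y} with hE
  have hEm : MeasurableSet E := measurableSet_lt measurable_const hw
  have hcap := hC {x | ∃ r, 0 < r ∧ r ≤ 1 ∧ c * μ (ball x r) ≤ μ (ball x r ∩ {y | 1 ≤ w y})}
    (fun n y => ((c⁻¹ * D : ℝ≥0) : ℝ≥0∞) * (ENNReal.ofReal (w y) + levelGradient g w τ n y)) ?_
  · refine hcap.trans ?_
    have e1 : ∀ n, ∫⁻ y, ((c⁻¹ * D : ℝ≥0) : ℝ≥0∞) *
        (ENNReal.ofReal (w y) + levelGradient g w τ n y) ∂μ = ((c⁻¹ * D : ℝ≥0) : ℝ≥0∞) *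
        (∫⁻ y, ENNReal.ofReal (w y) ∂μ + ∫⁻ y, levelGradient g w τ n y ∂μ) := fun n => by
      rw [lintegral_const_mul' _ _ ENNReal.coe_ne_top, lintegral_add_left hw.ennreal_ofReal]
    simp only [e1]
    rw [ENNReal.liminf_const_mul_of_ne_top ENNReal.coe_ne_top,
      liminf_const_add _ _ _ (by isBoundedDefault) (by isBoundedDefault)]
    calc _ ≤ C * (((c⁻¹ * D : ℝ≥0) : ℝ≥0∞) *
          (3 * ∫⁻ y, ENNReal.ofReal (w y) ∂μ + 3 * ∫⁻ x, g x ∂μ)) := by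
          gcongr
          exact le_mul_of_one_le_left (by positivity) (by norm_num)
      _ = _ := by push_cast; ring
  rintro x ⟨r, hr0, hr1, hr⟩
  suffices H : ∃ s, 0 < s ∧ s ≤ 1 ∧ c * μ (ball x s) ≤ D * (ENNReal.ofReal s *
      liminf (fun n => ∫⁻ y in ball x (lam * s),
        (ENNReal.ofReal (w y) + levelGradient g w τ n y) ∂μ) atTop) by
    obtain ⟨s, hs0, hs1, hs⟩ := H
    refine ⟨s, hs0, hs1, ?_⟩
    have e1 : ∀ n, ∫⁻ y in ball x (lam * s), ((c⁻¹ * D : ℝ≥0) : ℝ≥0∞) *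
        (ENNReal.ofReal (w y) + levelGradient g w τ n y) ∂μ = ((c⁻¹ * D : ℝ≥0) : ℝ≥0∞) *
        ∫⁻ y in ball x (lam * s), (ENNReal.ofReal (w y) + levelGradient g w τ n y) ∂μ :=
      fun n => lintegral_const_mul' _ _ ENNReal.coe_ne_top
    simp only [e1]
    rw [ENNReal.liminf_const_mul_of_ne_top ENNReal.coe_ne_top]
    calc μ (ball x s) = (c⁻¹ : ℝ≥0) * (c * μ (ball x s)) := by
          rw [← mul_assoc, ← ENNReal.coe_mul, inv_mul_cancel₀ hc.ne', ENNReal.coe_one, one_mul]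
      _ ≤ _ := mul_le_mul_right hs _
      _ = _ := by push_cast; ring
  let ρ : ℕ → ℝ := fun j => (1 / 2) ^ j
  have hρ0 : ∀ j, 0 < ρ j := fun j => by positivity
  have hρ1 : ∀ j, ρ j ≤ 1 := fun j => pow_le_one₀ (by norm_num) (by norm_num)
  have hρs : ∀ j, ρ j = 2 * ρ (j + 1) := fun j => by simp only [ρ, pow_succ]; ring
  have hex : ∃ j, c * μ (ball x (ρ j)) ≤ Cd * μ (ball x (ρ j) ∩ E) := by
    obtain ⟨j, hj1, hj2⟩ := exists_nat_pow_near_of_lt_one hr0 hr1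
      (show (0:ℝ) < 1 / 2 by norm_num) (by norm_num)
    have h1 : μ (ball x (ρ j)) ≤ Cd * μ (ball x r) := by
      refine le_trans (measure_mono (ball_subset_ball ?_)) (h x r hr0).2.1
      rw [hρs]
      exact mul_le_mul_of_nonneg_left hj1.le zero_le_two
    refine ⟨j, ?_⟩
    calc c * μ (ball x (ρ j)) ≤ c * (Cd * μ (ball x r)) := by gcongr
      _ = Cd * (c * μ (ball x r)) := by ring
      _ ≤ Cd * μ (ball x r ∩ {y | 1 ≤ w y}) := by gcongr
      _ ≤ _ := by
        gcongr
        intro y hy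
        exact lt_of_lt_of_le hτ.2 hy
  classical
  have hQ := Nat.find_spec hex
  have hmin := fun i => Nat.find_min hex (m := i)
  rcases hj : Nat.find hex with - | j
  · rw [hj] at hQ
    refine ⟨ρ 0, hρ0 0, hρ1 0, hQ.trans ?_⟩
    have h1 : μ (ball x (ρ 0) ∩ E) ≤ 2 * ∫⁻ y in ball x (ρ 0), ENNReal.ofReal |w y| ∂μ :=
      measure_le_two_mul_setLIntegral (measurableSet_ball.inter hEm) inter_subset_left
        fun y hy => (hτ.1.trans hy.2).le.trans (le_abs_self _)
    have h2 : ∫⁻ y in ball x (ρ 0), ENNReal.ofReal |w y| ∂μ ≤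
        liminf (fun n => ∫⁻ y in ball x (lam * ρ 0),
        (ENNReal.ofReal (w y) + levelGradient g w τ n y) ∂μ) atTop := by
      rw [← liminf_const (f := (atTop : Filter ℕ))
        (∫⁻ y in ball x (ρ 0), ENNReal.ofReal |w y| ∂μ)]
      refine liminf_le_liminf (Eventually.of_forall fun n => ?_)
      refine (lintegral_mono_set (ball_subset_ball ?_)).trans (lintegral_mono fun y => ?_)
      · nlinarith [hρ0 0]
      · rw [abs_of_nonneg (hw0 y)]
        exact le_self_add
    have h3 : ENNReal.ofReal (ρ 0) = 1 := by simp [ρ]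
    rw [h3, one_mul]
    refine (mul_le_mul_right (h1.trans (mul_le_mul_right h2 2)) (Cd : ℝ≥0∞)).trans ?_
    rw [← mul_assoc]
    gcongr
    calc (Cd : ℝ≥0∞) * 2 = ((2 * Cd : ℝ≥0) : ℝ≥0∞) := by push_cast; ring
      _ ≤ D := by
        gcongr
        exact le_self_add
  · rw [hj] at hQ
    have hnot := not_le.1 (hmin j (by omega))
    refine ⟨ρ j, hρ0 j, hρ1 j, ?_⟩
    have hCd' : (1 : ℝ≥0∞) ≤ Cd := by exact_mod_cast hCd
    have h1 : c * μ (ball x (ρ j)) ≤ Cd ^ 2 * μ (ball x (ρ j) ∩ E) := by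
      calc c * μ (ball x (ρ j)) ≤ c * (Cd * μ (ball x (ρ (j + 1)))) := by
            gcongr
            rw [hρs]
            exact (h x _ (hρ0 _)).2.1
        _ = Cd * (c * μ (ball x (ρ (j + 1)))) := by ring
        _ ≤ Cd * (Cd * μ (ball x (ρ (j + 1)) ∩ E)) := by gcongr
        _ ≤ Cd * (Cd * μ (ball x (ρ j) ∩ E)) := by
            gcongr
            rw [hρs j]
            linarith [hρ0 (j + 1)]
        _ = _ := by ring
    have h2 : c * μ (ball x (ρ j)) ≤ Cd ^ 2 * μ (ball x (ρ j) ∩ {y | w y ≤ τ}) := by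
      have hfin := (h.measure_ball_lt_top x (ρ j)).ne
      have hsplit : μ (ball x (ρ j)) ≤
          μ (ball x (ρ j) ∩ E) + μ (ball x (ρ j) ∩ {y | w y ≤ τ}) := by
        refine le_trans (measure_mono fun y hy => ?_) (measure_union_le _ _)
        rcases lt_or_ge τ (w y) with hy2 | hy2
        · exact Or.inl ⟨hy, hy2⟩
        · exact Or.inr ⟨hy, hy2⟩
      have hhalf : (c : ℝ≥0∞) * μ (ball x (ρ j)) + c * μ (ball x (ρ j)) ≤ μ (ball x (ρ j)) := by
        rw [← add_mul, ← ENNReal.coe_add]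
        refine mul_le_of_le_one_left (by positivity) ?_
        have : c + c ≤ 1 := by
          calc c + c ≤ 1 / 2 + 1 / 2 := by gcongr
            _ = 1 := by norm_num
        exact_mod_cast this
      have hlt : μ (ball x (ρ j) ∩ E) ≤ c * μ (ball x (ρ j)) :=
        le_trans (le_mul_of_one_le_left (by positivity) hCd') hnot.le
      have h3 : c * μ (ball x (ρ j)) ≤ μ (ball x (ρ j) ∩ {y | w y ≤ τ}) := by
        refine (ENNReal.add_le_add_iff_left (a := c * μ (ball x (ρ j)))
          (ENNReal.mul_ne_top ENNReal.coe_ne_top hfin)).1 ?_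
        exact hhalf.trans (hsplit.trans (by gcongr))
      refine h3.trans (le_mul_of_one_le_left (by positivity) (one_le_pow₀ hCd'))
    have h3 : c * μ (ball x (ρ j)) ≤ Cd ^ 2 *
        min (μ (ball x (ρ j) ∩ E)) (μ (ball x (ρ j) ∩ {y | w y ≤ τ})) := by
      rcases min_choice (μ (ball x (ρ j) ∩ E)) (μ (ball x (ρ j) ∩ {y | w y ≤ τ})) with h | h <;>
        rw [h] <;> assumption
    have h4 := (hPI.min_measure_le h hlam hw hg τ (hρ0 j) (x := x)).trans
      (mul_le_mul_right (liminf_le_liminf (Eventually.of_forall fun n =>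
        lintegral_mono fun y => le_add_self (a := levelGradient g w τ n y)
          (b := ENNReal.ofReal (w y)))) _)
    set Z := liminf (fun n => ∫⁻ y in ball x (lam * ρ j),
      (ENNReal.ofReal (w y) + levelGradient g w τ n y) ∂μ) atTop
    calc c * μ (ball x (ρ j)) ≤ Cd ^ 2 * _ := h3
      _ ≤ Cd ^ 2 * (2 * ENNReal.ofReal (CP * ρ j) * Z) := mul_le_mul_right h4 _
      _ = ((2 * Cd ^ 2 * CP.toNNReal : ℝ≥0) : ℝ≥0∞) * (ENNReal.ofReal (ρ j) * Z) := by
          rw [ENNReal.ofReal_mul' (hρ0 j).le]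
          simp only [ENNReal.ofReal]
          push_cast
          ring
      _ ≤ D * (ENNReal.ofReal (ρ j) * Z) := by
          gcongr
          exact le_add_self

end Density

section LipschitzApproximation

variable {μ : Measure X} {Cd : ℝ≥0} {CP lam : ℝ}

lemma ofReal_abs_setAverage_sub_mul_le {S : Set X} (hS : μ S ≠ ⊤) {u : X → ℝ}
    (hu : IntegrableOn u S μ) (c : ℝ) :
    ENNReal.ofReal |(⨍ x in S, u x ∂μ) - c| * μ S ≤ ∫⁻ x in S, ENNReal.ofReal |u x - c| ∂μ := by
  have h1 : μ.real S * ((⨍ x in S, u x ∂μ) - c) = ∫ x in S, (u x - c) ∂μ := by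
    have := measure_smul_setAverage (μ := μ) u hS
    rw [smul_eq_mul] at this
    rw [integral_sub hu (integrableOn_const hS), setIntegral_const, mul_sub, this, smul_eq_mul]
  have h2 : ENNReal.ofReal |(⨍ x in S, u x ∂μ) - c| * μ S = ‖∫ x in S, (u x - c) ∂μ‖ₑ := by
    rw [← h1, Real.enorm_eq_ofReal_abs, abs_mul, abs_of_nonneg measureReal_nonneg,
      ENNReal.ofReal_mul measureReal_nonneg, ofReal_measureReal hS, mul_comm]
  rw [h2]
  simpa only [Real.enorm_eq_ofReal_abs] using enorm_integral_le_lintegral_enorm (μ := μ.restrict S)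
    (fun x => u x - c)

/-- Comparison of averages over a ball and over a subset of comparable measure. -/
lemma PoincareIneq.abs_setAverage_sub_le (hPI : PoincareIneq μ CP lam) (h : DoublingWith μ Cd)
    (hCP : 0 < CP) (hlam : 1 ≤ lam) {u : X → ℝ} {g : X → ℝ≥0∞} {M : ℝ} (hu : Measurable u)
    [BorelSpace X] (hM : ∀ x, |u x| ≤ M) (hg : IsUpperGradient g u) {t : ℝ≥0} {x : X} {r : ℝ}
    (hr : 0 < r) (ht : ∫⁻ y in ball x (lam * r), g y ∂μ ≤ t * μ (ball x (lam * r)))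
    {S : Set X} (hS : S ⊆ ball x r) {k : ℕ} (hk : μ (ball x r) ≤ (Cd : ℝ≥0∞) ^ k * μ S) :
    |(⨍ y in S, u y ∂μ) - ⨍ y in ball x r, u y ∂μ| ≤ CP * r * t * Cd ^ k := by
  have hB := h x r hr
  have hSt : μ S ≠ ⊤ := ne_top_of_le_ne_top hB.2.2.ne (measure_mono hS)
  have hS0 : μ S ≠ 0 := fun h0 => by
    rw [h0, mul_zero] at hk
    exact (not_lt.2 hk) hB.1
  have hP := (ENNReal.div_le_iff hB.1.ne' hB.2.2.ne).1
    (hPI x r hr u g (h.locallyIntegrable hu M hM) hg)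
  have h1 := ofReal_abs_setAverage_sub_mul_le hSt
    (Measure.integrableOn_of_bounded (M := M) hSt hu.aestronglyMeasurable (Eventually.of_forall hM))
    (⨍ y in ball x r, u y ∂μ)
  have hlr := h x (lam * r) (by positivity)
  have h2 : (∫⁻ y in ball x (lam * r), g y ∂μ) / μ (ball x (lam * r)) ≤ t :=
    ENNReal.div_le_of_le_mul ht
  have h3 : ENNReal.ofReal |(⨍ y in S, u y ∂μ) - ⨍ y in ball x r, u y ∂μ| * μ S ≤
      ENNReal.ofReal (CP * r * t * Cd ^ k) * μ S := by
    calc _ ≤ _ := h1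
      _ ≤ ∫⁻ y in ball x r, ENNReal.ofReal |u y - ⨍ z in ball x r, u z ∂μ| ∂μ :=
          lintegral_mono_set hS
      _ ≤ _ := hP
      _ ≤ ENNReal.ofReal (CP * r) * t * ((Cd : ℝ≥0∞) ^ k * μ S) := by gcongr
      _ = _ := by
          rw [ENNReal.ofReal_mul (p := CP * r * t) (by positivity),
            ENNReal.ofReal_mul (p := CP * r) (by positivity),
            ENNReal.ofReal_pow (by positivity), ENNReal.ofReal_coe_nnreal,
            ENNReal.ofReal_coe_nnreal]
          ring
  exact (ENNReal.ofReal_le_ofReal_iff (by positivity)).1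
    ((ENNReal.mul_le_mul_iff_left hS0 hSt).1 h3)

/-- Quantitative Lipschitz continuity between points where the upper gradient has controlled
averages. -/
lemma PoincareIneq.ae_lipschitz [BorelSpace X] (hPI : PoincareIneq μ CP lam)
    (h : DoublingWith μ Cd) (hCd : 1 ≤ Cd) (hCP : 0 < CP) (hlam : 1 ≤ lam) {u : X → ℝ}
    {g : X → ℝ≥0∞} {M : ℝ} (hu : Measurable u) (hM0 : 0 ≤ M) (hM : ∀ x, |u x| ≤ M)
    (hg : IsUpperGradient g u) :
    ∃ N, μ N = 0 ∧ ∀ (t : ℝ≥0) (x y : X), x ∉ N → y ∉ N →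
      (∀ r, 0 < r → r ≤ 4 * lam → ∫⁻ z in ball x r, g z ∂μ ≤ t * μ (ball x r)) →
      (∀ r, 0 < r → r ≤ 4 * lam → ∫⁻ z in ball y r, g z ∂μ ≤ t * μ (ball y r)) →
      |u x - u y| ≤ (24 * CP * t * Cd ^ 3 + 2 * M) * dist x y := by
  have := h.secondCountableTopology
  have := h.isUnifLocDoublingMeasure
  have := h.isLocallyFiniteMeasure
  have hae := IsUnifLocDoublingMeasure.ae_tendsto_average μ (h.locallyIntegrable hu M hM) 0
  refine ⟨_, hae, fun t x y hx hy hgx hgy => ?_⟩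
  simp only [mem_compl_iff, not_not, mem_ofPred_eq] at hx hy
  have hCd' : (1 : ℝ) ≤ Cd := by exact_mod_cast hCd
  have hPt : 0 ≤ CP * t := by positivity
  rcases eq_or_ne x y with rfl | hxy
  · simp
  set d := dist x y with hd
  have hd0 : 0 < d := dist_pos.2 hxy
  rcases lt_or_ge 1 d with hd1 | hd1
  · have h1 : |u x - u y| ≤ 2 * M := by
      have := abs_sub (u x) (u y)
      linarith [hM x, hM y]
    have h2 : 0 ≤ 24 * CP * t * (Cd : ℝ) ^ 3 := by positivity
    nlinarith
  have main : ∀ z : X, (∀ r, 0 < r → r ≤ 4 * lam →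
      ∫⁻ z' in ball z r, g z' ∂μ ≤ t * μ (ball z r)) →
      (∀ {ι : Type} {l : Filter ι} (w : ι → X) (δ : ι → ℝ), Tendsto δ l (𝓝[>] 0) →
        (∀ᶠ j in l, z ∈ closedBall (w j) (0 * δ j)) →
        Tendsto (fun j => ⨍ y in closedBall (w j) (δ j), u y ∂μ) l (𝓝 (u z))) →
      |(⨍ y in closedBall z d, u y ∂μ) - u z| ≤ 8 * (CP * t) * Cd ^ 2 * d := by
    intro z hgz hz
    let ρ : ℕ → ℝ := fun k => d / 2 ^ k
    have hρ0 : ∀ k, 0 < ρ k := fun k => by positivity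
    have hρ1 : ∀ k, ρ k ≤ 1 := fun k =>
      (div_le_self hd0.le (one_le_pow₀ one_le_two)).trans hd1
    have hρs : ∀ k, ρ k = 2 * ρ (k + 1) := fun k => by simp only [ρ, pow_succ]; field_simp
    have hlim : Tendsto (fun k => ⨍ y in closedBall z (ρ k), u y ∂μ) atTop (𝓝 (u z)) := by
      refine hz (fun _ => z) ρ ?_ (Eventually.of_forall fun _ => by simp)
      refine tendsto_nhdsWithin_iff.2 ⟨?_, Eventually.of_forall hρ0⟩
      have := (tendsto_pow_atTop_nhds_zero_of_lt_one (r := (1 / 2 : ℝ)) (by norm_num)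
        (by norm_num)).const_mul d
      simpa [ρ, div_eq_mul_inv] using this
    have hstep : ∀ k, dist (⨍ y in closedBall z (ρ k), u y ∂μ)
        (⨍ y in closedBall z (ρ (k + 1)), u y ∂μ) ≤ 8 * (CP * t) * Cd ^ 2 * d / 2 / 2 ^ k := by
      intro k
      have hr : 0 < 2 * ρ k := by linarith [hρ0 k]
      have ht := hgz (lam * (2 * ρ k)) (by positivity) (by nlinarith [hρ1 k])
      have e1 := hPI.abs_setAverage_sub_le h hCP hlam hu hM hg hr ht
        (S := closedBall z (ρ k)) (k := 2) (closedBall_subset_ball (by linarith [hρ0 k])) (by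
          refine (h.measure_ball_le (hρ0 k) 2 (by linarith [hρ0 k])).trans ?_
          gcongr
          exact ball_subset_closedBall)
      have e2 := hPI.abs_setAverage_sub_le h hCP hlam hu hM hg hr ht
        (S := closedBall z (ρ (k + 1))) (k := 2)
        (closedBall_subset_ball (by linarith [hρ0 (k + 1), hρs k])) (by
          refine (h.measure_ball_le (hρ0 (k + 1)) 2 (by linarith [hρs k])).trans ?_
          gcongr
          exact ball_subset_closedBall)
      rw [Real.dist_eq]
      refine (abs_sub_le _ (⨍ y in ball z (2 * ρ k), u y ∂μ) _).trans ?_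
      rw [abs_sub_comm _ (⨍ y in closedBall z (ρ (k + 1)), u y ∂μ)]
      refine (add_le_add e1 e2).trans (le_of_eq ?_)
      simp only [ρ]
      field_simp
      ring
    have := dist_le_of_le_geometric_two_of_tendsto₀ hstep hlim
    simpa [ρ, Real.dist_eq] using this
  have mx := main x hgx fun w δ hδ hw => hx w δ hδ hw
  have my := main y hgy fun w δ hδ hw => hy w δ hδ hw
  have hr : 0 < 4 * d := by linarith
  have ht := hgx (lam * (4 * d)) (by positivity) (by nlinarith)
  have e1 := hPI.abs_setAverage_sub_le h hCP hlam hu hM hg hr ht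
    (S := closedBall x d) (k := 3) (closedBall_subset_ball (by linarith)) (by
      refine (h.measure_ball_le hd0 3 (by linarith)).trans ?_
      gcongr
      exact ball_subset_closedBall)
  have e2 := hPI.abs_setAverage_sub_le h hCP hlam hu hM hg hr ht
    (S := closedBall y d) (k := 3) (fun z hz => by
      have := dist_triangle z y x
      rw [dist_comm y x, ← hd] at this
      rw [mem_closedBall] at hz
      rw [mem_ball]
      linarith) (by
      refine (measure_mono (ball_subset_ball' (y := y) (ε₂ := 2 ^ 3 * d) ?_)).trans
        ((h.measure_ball_le hd0 3 le_rfl).trans ?_)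
      · rw [← hd]; linarith
      · gcongr
        exact ball_subset_closedBall)
  have hpow : CP * t * (Cd : ℝ) ^ 2 * d ≤ CP * t * (Cd : ℝ) ^ 3 * d := by
    gcongr
    norm_num
  rw [abs_le] at mx my e1 e2 ⊢
  constructor <;> nlinarith [mx.1, mx.2, my.1, my.2, e1.1, e1.2, e2.1, e2.2, mul_nonneg hM0 hd0.le]

end LipschitzApproximation

section Density

variable {μ : Measure X} {Cd : ℝ≥0} {CP lam : ℝ}

/-- Weak type estimate for the set where averages of `g` exceed a large level. -/
lemma DoublingWith.mul_measure_large_average_le [BorelSpace X] (h : DoublingWith μ Cd)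
    {g : X → ℝ≥0∞} (hg : Measurable g) (R : ℝ) (m : ℕ) :
    (m : ℝ≥0∞) * μ {x | ¬ ∀ r, 0 < r → r ≤ R →
      ∫⁻ z in ball x r, g z ∂μ ≤ ((2 * m : ℝ≥0) : ℝ≥0∞) * μ (ball x r)} ≤
      (Cd : ℝ≥0∞) ^ 3 * ∫⁻ x in {x | (m : ℝ≥0∞) < g x}, g x ∂μ := by
  rw [← lintegral_indicator (measurableSet_lt measurable_const hg)]
  refine h.measure_le_of_forall_ball _ _ R m fun x hx => ?_
  simp only [mem_ofPred_eq, not_forall, not_le] at hx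
  obtain ⟨r, hr, hrR, hlt⟩ := hx
  refine ⟨r, hr, hrR, ?_⟩
  have h1 := hlt.le.trans (setLIntegral_le_tail_add g (m : ℝ≥0∞) (ball x r))
  have h2 : ((2 * m : ℝ≥0) : ℝ≥0∞) * μ (ball x r) = m * μ (ball x r) + m * μ (ball x r) := by
    push_cast
    ring
  rw [h2] at h1
  exact (ENNReal.add_le_add_iff_right
    (ENNReal.mul_ne_top (natCast_ne_top m) (h.measure_ball_lt_top x r).ne)).1 h1

/-- Bounded functions with integrable upper gradient are approximated by continuous ones. -/
lemma PoincareIneq.exists_continuous_approx [BorelSpace X] (hPI : PoincareIneq μ CP lam)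
    (h : DoublingWith μ Cd) (hCd : 1 ≤ Cd) (hCP : 0 < CP) (hlam : 1 ≤ lam) {u : X → ℝ}
    {g : X → ℝ≥0∞} {M : ℝ≥0} (hu : Measurable u) (hM : ∀ x, |u x| ≤ M)
    (hg : IsUpperGradient g u) (hfin : ∫⁻ x, g x ∂μ ≠ ⊤) {η : ℝ≥0∞} (hη : 0 < η) :
    ∃ (v : X → ℝ) (k : X → ℝ≥0∞), Continuous v ∧ IsUpperGradient k (fun x => u x - v x) ∧
      ∫⁻ x, ENNReal.ofReal |u x - v x| ∂μ + ∫⁻ x, k x ∂μ < η := by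
  obtain ⟨N, hN, hlip⟩ := hPI.ae_lipschitz h hCd hCP hlam hu M.coe_nonneg hM hg
  let A : ℕ → Set X := fun m => {x | ¬ ∀ r, 0 < r → r ≤ 4 * lam →
      ∫⁻ z in ball x r, g z ∂μ ≤ ((2 * m : ℝ≥0) : ℝ≥0∞) * μ (ball x r)} ∪ N
  set K : ℝ≥0 := 24 * CP.toNNReal * 2 * Cd ^ 3 with hK
  have hmA : Tendsto (fun m : ℕ => (m : ℝ≥0∞) * μ (A m)) atTop (𝓝 0) := by
    have h1 := ENNReal.Tendsto.const_mul (a := (Cd : ℝ≥0∞) ^ 3)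
      (tendsto_setLIntegral_superlevel hg.1 hfin) (Or.inr (by finiteness))
    rw [mul_zero] at h1
    refine tendsto_of_tendsto_of_tendsto_of_le_of_le tendsto_const_nhds h1
      (fun _ => by positivity) fun m => ?_
    refine le_trans ?_ (h.mul_measure_large_average_le hg.1 (4 * lam) m)
    exact mul_le_mul_right ((measure_union_le _ _).trans (by rw [hN, add_zero])) _
  have hA : Tendsto (fun m => μ (A m)) atTop (𝓝 0) := by
    refine tendsto_of_tendsto_of_tendsto_of_le_of_le' tendsto_const_nhds hmA
      (Eventually.of_forall fun _ => by positivity) ?_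
    filter_upwards [eventually_ge_atTop 1] with m hm
    exact le_mul_of_one_le_left (by positivity) (by exact_mod_cast hm)
  have hgA := tendsto_setLIntegral_zero hfin hA
  have hginv : Tendsto (fun m : ℕ => ((m + 1 : ℕ) : ℝ≥0∞)⁻¹ * ∫⁻ x, g x ∂μ) atTop (𝓝 0) := by
    have := ENNReal.Tendsto.mul_const (b := ∫⁻ x, g x ∂μ)
      (ENNReal.tendsto_inv_nat_nhds_zero.comp (tendsto_add_atTop_nat 1)) (Or.inr hfin)
    simpa using this
  have htot : Tendsto (fun m : ℕ => 2 * M * μ (A m) + (∫⁻ x in A m, g x ∂μ +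
      (K * (m * μ (A m)) + 2 * M * μ (A m)) + ((m + 1 : ℕ) : ℝ≥0∞)⁻¹ * ∫⁻ x, g x ∂μ))
      atTop (𝓝 0) := by
    have h1 := ENNReal.Tendsto.const_mul (a := 2 * (M : ℝ≥0∞)) hA (Or.inr (by finiteness))
    have h2 := ENNReal.Tendsto.const_mul (a := (K : ℝ≥0∞)) hmA (Or.inr (by finiteness))
    have := h1.add ((hgA.add (h2.add h1)).add hginv)
    simpa using this
  obtain ⟨m, hm⟩ := (htot.eventually (gt_mem_nhds hη)).exists
  set L : ℝ≥0 := K * m + 2 * M with hL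
  have hlipA : LipschitzOnWith L u (A m)ᶜ := by
    refine LipschitzOnWith.of_dist_le_mul fun x hx y hy => ?_
    simp only [A, compl_union, mem_inter_iff, mem_compl_iff, mem_ofPred_eq, not_not] at hx hy
    have := hlip (2 * m) x y hx.2 hy.2 hx.1 hy.1
    rw [Real.dist_eq]
    refine this.trans (le_of_eq ?_)
    rw [hL, hK]
    push_cast
    rw [Real.coe_toNNReal _ hCP.le]
    ring
  obtain ⟨v₀, hv₀, hv₀u⟩ := hlipA.extend_real
  set v : X → ℝ := fun x => max (-M) (min M (v₀ x)) with hv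
  have hvL : LipschitzWith L v := (hv₀.const_min _).const_max _
  have hvM : ∀ x, |v x| ≤ M := fun x => abs_le.2 ⟨le_max_left _ _,
    max_le (by linarith [M.coe_nonneg]) (min_le_left _ _)⟩
  have huv : ∀ x ∉ A m, u x - v x = 0 := fun x hx => by
    have h1 := hv₀u (show x ∈ (A m)ᶜ from hx)
    have h2 := abs_le.1 (hM x)
    rw [hv]
    simp only [← h1, min_eq_right h2.2, max_eq_right h2.1, sub_self]
  have hfm : Measurable fun x => u x - v x := hu.sub hvL.continuous.measurable
  set Z : Set X := {x | u x - v x ≠ 0} with hZ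
  have hZm : MeasurableSet Z := hfm (measurableSet_singleton 0).compl
  have hZA : Z ⊆ A m := fun x hx => by
    by_contra hc
    exact hx (huv x hc)
  have hk : IsUpperGradient (fun x => g x + L) (fun x => u x - v x) := by
    have := hg.comb isUpperGradient_zero 1 0 L (f := fun x => u x - v x) (by
      intro a b
      have h1 := hvL.dist_le_mul a b
      rw [Real.dist_eq] at h1
      have h2 : |u a - v a - (u b - v b)| ≤ |u a - u b| + |v a - v b| := by
        rw [show u a - v a - (u b - v b) = (u a - u b) - (v a - v b) by ring]
        exact abs_sub _ _
      simp only [NNReal.coe_one, one_mul, sub_self, abs_zero, mul_zero, add_zero]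
      linarith)
    simpa using this
  refine ⟨v, fun x => Z.indicator (fun x => g x + L) x + (((m + 1 : ℕ) : ℝ≥0)⁻¹ : ℝ≥0) * g x,
    hvL.continuous, ?_, lt_of_le_of_lt ?_ hm⟩
  · refine hk.of_le_on_support (((hg.1.add_const _).indicator hZm).add (hg.1.const_mul _))
      ((m + 1 : ℕ) : ℝ≥0) L (fun x => ?_) fun x hx => ?_
    · gcongr
      rw [mul_add, ← mul_assoc, ← ENNReal.coe_mul, mul_inv_cancel₀ (by positivity),
        ENNReal.coe_one, one_mul]
      exact le_add_self
    · rw [indicator_of_mem (by exact hx)]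
      exact le_self_add
  · gcongr ?_ + ?_
    · calc ∫⁻ x, ENNReal.ofReal |u x - v x| ∂μ
          ≤ ∫⁻ x, Z.indicator (fun _ => 2 * (M : ℝ≥0∞)) x ∂μ := by
            refine lintegral_mono fun x => ?_
            by_cases hx : u x - v x = 0
            · simp [hx]
            · rw [indicator_of_mem (by exact hx), ← ENNReal.ofReal_coe_nnreal (p := M),
                ← ENNReal.ofReal_ofNat 2, ← ENNReal.ofReal_mul zero_le_two]
              refine ENNReal.ofReal_le_ofReal ?_
              have := abs_sub (u x) (v x)
              linarith [hM x, hvM x]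
        _ = 2 * M * μ Z := lintegral_indicator_const hZm _
        _ ≤ _ := by gcongr
    · rw [lintegral_add_right _ (hg.1.const_mul _), lintegral_indicator hZm,
        lintegral_add_right _ measurable_const, lintegral_const, Measure.restrict_apply_univ,
        lintegral_const_mul' _ _ ENNReal.coe_ne_top, ENNReal.coe_inv (by positivity),
        ENNReal.coe_natCast]
      gcongr ?_ + ?_ + ?_
      · exact lintegral_mono_set hZA
      · calc (L : ℝ≥0∞) * μ Z ≤ L * μ (A m) := by gcongr
          _ = _ := by
            rw [hL]
            push_cast
            ring
      · exact le_rfl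

end Density

section ApproximateContinuity

variable {μ : Measure X} {Cd : ℝ≥0} {CP lam : ℝ}

lemma ENNReal_le_of_forall_le_add_mul {a b K : ℝ≥0∞} (hK : K ≠ ⊤)
    (h : ∀ η : ℝ≥0∞, 0 < η → a ≤ b + K * η) : a ≤ b := by
  have h1 : Tendsto (fun n : ℕ => b + K * (n : ℝ≥0∞)⁻¹) atTop (𝓝 (b + K * 0)) :=
    tendsto_const_nhds.add
      (ENNReal.Tendsto.const_mul ENNReal.tendsto_inv_nat_nhds_zero (Or.inr hK))
  rw [mul_zero, add_zero] at h1
  exact ge_of_tendsto' h1 fun n => h _ (by simp)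

/-- `u` is approximately continuous at `x`. -/
def ApproxContinuousAt (μ : Measure X) (u : X → ℝ) (x : X) : Prop :=
  ∀ δ : ℝ, 0 < δ →
    Tendsto (fun r : ℝ => μ (ball x r ∩ {y | δ ≤ |u y - u x|}) / μ (ball x r)) (𝓝[>] 0) (𝓝 0)

lemma PoincareIneq.capacity1_oscillation_eq_zero [BorelSpace X] (hPI : PoincareIneq μ CP lam)
    (h : DoublingWith μ Cd) (hCd : 1 ≤ Cd) (hCP : 0 < CP) (hlam : 1 ≤ lam) {u : X → ℝ}
    {g : X → ℝ≥0∞} {M : ℝ≥0} (hu : Measurable u) (hM : ∀ x, |u x| ≤ M)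
    (hg : IsUpperGradient g u) (hfin : ∫⁻ x, g x ∂μ ≠ ⊤) {c : ℝ≥0} (hc : 0 < c)
    (hc2 : c ≤ 1 / 2) :
    capacity1 μ {x | ∃ᶠ r in 𝓝[>] (0:ℝ),
      c * μ (ball x r) ≤ μ (ball x r ∩ {y | (c : ℝ) ≤ |u y - u x|})} = 0 := by
  obtain ⟨C, hC⟩ := hPI.exists_capacity1_density_le h hCd hlam hc hc2
  have hc' : (0:ℝ) < c := hc
  refine le_antisymm (ENNReal_le_of_forall_le_add_mul (K := (((1 + C) * (3 / c) : ℝ≥0) : ℝ≥0∞))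
    ENNReal.coe_ne_top fun η hη => ?_) (by positivity)
  obtain ⟨v, k, hv, hk, hlt⟩ := hPI.exists_continuous_approx h hCd hCP hlam hu hM hg hfin hη
  set w : X → ℝ := fun x => ((3 / c : ℝ≥0) : ℝ) * |u x - v x| with hw
  have hwm : Measurable w := ((hu.sub hv.measurable).abs).const_mul _
  have hw0 : ∀ x, 0 ≤ w x := fun x => by positivity
  have hwg : IsUpperGradient (fun x => ((3 / c : ℝ≥0) : ℝ≥0∞) * k x) w := by
    have := hk.comb isUpperGradient_zero (3 / c) 0 0 (f := w) (by
      intro a b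
      simp only [hw, ← mul_sub, abs_mul, NNReal.abs_eq, NNReal.coe_zero, zero_mul, add_zero]
      exact mul_le_mul_of_nonneg_left (abs_abs_sub_abs_le (u a - v a) (u b - v b))
        (NNReal.coe_nonneg _))
    simpa using this
  have hsum : ∫⁻ x, ENNReal.ofReal (w x) ∂μ + ∫⁻ x, ((3 / c : ℝ≥0) : ℝ≥0∞) * k x ∂μ ≤
      ((3 / c : ℝ≥0) : ℝ≥0∞) * η := by
    have h1 : ∀ x, ENNReal.ofReal (w x) = ((3 / c : ℝ≥0) : ℝ≥0∞) * ENNReal.ofReal |u x - v x| :=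
      fun x => by rw [hw, ENNReal.ofReal_mul (by positivity), ENNReal.ofReal_coe_nnreal]
    simp only [h1]
    rw [lintegral_const_mul' _ _ ENNReal.coe_ne_top, lintegral_const_mul' _ _ ENNReal.coe_ne_top,
      ← mul_add]
    gcongr
  have hsub : {x | ∃ᶠ r in 𝓝[>] (0:ℝ),
      c * μ (ball x r) ≤ μ (ball x r ∩ {y | (c : ℝ) ≤ |u y - u x|})} ⊆ {x | 1 ≤ w x} ∪
      {x | ∃ r, 0 < r ∧ r ≤ 1 ∧ c * μ (ball x r) ≤ μ (ball x r ∩ {y | 1 ≤ w y})} := by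
    intro x hx
    rcases le_or_gt 1 (w x) with h1 | h1
    · exact Or.inl h1
    refine Or.inr ?_
    have hwle : ∀ y, 1 ≤ w y ↔ c / 3 ≤ |u y - v y| := fun y => by
      simp only [hw]
      push_cast
      rw [div_mul_eq_mul_div, le_div_iff₀ hc', one_mul, div_le_iff₀' (by norm_num)]
    have hfx : |u x - v x| < c / 3 := by
      by_contra hcon
      exact absurd ((hwle x).2 (not_lt.1 hcon)) (not_le.2 h1)
    obtain ⟨r₀, hr₀, hvr⟩ := Metric.continuousAt_iff.1 (hv.continuousAt (x := x)) (c / 3)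
      (by positivity)
    have hev : ∀ᶠ r in 𝓝[>] (0:ℝ), 0 < r ∧ r ≤ 1 ∧ r ≤ r₀ := by
      filter_upwards [self_mem_nhdsWithin, nhdsWithin_le_nhds (Iic_mem_nhds one_pos),
        nhdsWithin_le_nhds (Iic_mem_nhds hr₀)] with r h1 h2 h3
      exact ⟨h1, h2, h3⟩
    obtain ⟨r, hr, hr0, hr1, hrr⟩ := ((show ∃ᶠ r in 𝓝[>] (0:ℝ),
      c * μ (ball x r) ≤ μ (ball x r ∩ {y | (c : ℝ) ≤ |u y - u x|}) from hx).and_eventually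
        hev).exists
    refine ⟨r, hr0, hr1, hr.trans (measure_mono ?_)⟩
    rintro y ⟨hy, hyu⟩
    refine ⟨hy, (hwle y).2 ?_⟩
    have hyu : (c : ℝ) ≤ |u y - u x| := hyu
    have h2 : |v y - v x| < c / 3 := by
      rw [← Real.dist_eq]
      exact hvr (lt_of_lt_of_le hy hrr)
    have h3 : |u y - u x| ≤ |u y - v y| + |v y - v x| + |u x - v x| := by
      rw [show u y - u x = (u y - v y) + (v y - v x) - (u x - v x) by ring]
      exact (abs_sub _ _).trans (by gcongr; exact abs_add_le _ _)
    linarith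
  calc _ ≤ _ := capacity1_mono hsub
    _ ≤ _ := capacity1_union_le _ _
    _ ≤ ((3 / c : ℝ≥0) : ℝ≥0∞) * η + C * (((3 / c : ℝ≥0) : ℝ≥0∞) * η) :=
      add_le_add ((capacity1_superlevel_le hwm hw0 hwg).trans hsum)
        ((hC w _ hwm hw0 hwg).trans (by gcongr))
    _ = _ := by
      push_cast
      ring

/-- Bounded functions with integrable upper gradient are approximately continuous quasi
everywhere. -/
lemma PoincareIneq.capacity1_not_approxContinuousAt_of_bounded [BorelSpace X]
    (hPI : PoincareIneq μ CP lam) (h : DoublingWith μ Cd) (hCd : 1 ≤ Cd) (hCP : 0 < CP)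
    (hlam : 1 ≤ lam) {u : X → ℝ} {g : X → ℝ≥0∞} {M : ℝ≥0} (hu : Measurable u)
    (hM : ∀ x, |u x| ≤ M) (hg : IsUpperGradient g u) (hfin : ∫⁻ x, g x ∂μ ≠ ⊤) :
    capacity1 μ {x | ¬ ApproxContinuousAt μ u x} = 0 := by
  let c : ℕ → ℝ≥0 := fun m => ((m + 2 : ℕ) : ℝ≥0)⁻¹
  have hc : ∀ m, 0 < c m := fun m => by positivity
  have hc2 : ∀ m, c m ≤ 1 / 2 := fun m => by
    rw [one_div]
    refine inv_anti₀ (by norm_num) ?_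
    push_cast
    exact le_add_self
  have hclim : Tendsto (fun m => (c m : ℝ≥0∞)) atTop (𝓝 0) := by
    have := ENNReal.tendsto_inv_nat_nhds_zero.comp (tendsto_add_atTop_nat 2)
    refine this.congr fun m => ?_
    simp only [c, Function.comp_apply]
    rw [ENNReal.coe_inv (by positivity), ENNReal.coe_natCast]
  refine le_antisymm ((capacity1_mono ?_).trans (capacity1_iUnion_eq_zero fun m =>
    hPI.capacity1_oscillation_eq_zero h hCd hCP hlam hu hM hg hfin (hc m) (hc2 m)).le)
    (by positivity)
  intro x hx
  simp only [ApproxContinuousAt, mem_ofPred_eq, ENNReal.tendsto_nhds_zero, not_forall] at hx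
  obtain ⟨δ, hδ, ε, hε, hx⟩ := hx
  obtain ⟨m, hm1, hm2⟩ := ((hclim.eventually (gt_mem_nhds hε)).and
    (hclim.eventually (gt_mem_nhds (ENNReal.ofReal_pos.2 hδ)))).exists
  refine mem_iUnion.2 ⟨m, ?_⟩
  rw [not_eventually] at hx
  have hx' := hx.and_eventually (self_mem_nhdsWithin (a := (0:ℝ)) (s := Ioi 0))
  refine hx'.mono fun r ⟨hr, hr0⟩ => ?_
  have hB := h x r hr0
  have h1 := (ENNReal.le_div_iff_mul_le (Or.inl hB.1.ne') (Or.inl hB.2.2.ne)).1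
    (hm1.trans (not_le.1 hr)).le
  refine h1.trans (measure_mono (inter_subset_inter_right _ fun y hy => ?_))
  have hcd : (c m : ℝ) ≤ δ := by
    rw [← ENNReal.ofReal_coe_nnreal] at hm2
    exact ((ENNReal.ofReal_lt_ofReal_iff hδ).1 hm2).le
  exact le_trans hcd hy

/-- Functions with integrable upper gradient are approximately continuous quasi everywhere. -/
lemma PoincareIneq.capacity1_not_approxContinuousAt [BorelSpace X]
    (hPI : PoincareIneq μ CP lam) (h : DoublingWith μ Cd) (hCd : 1 ≤ Cd) (hCP : 0 < CP)
    (hlam : 1 ≤ lam) {u : X → ℝ} {g : X → ℝ≥0∞} (hu : Measurable u)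
    (hg : IsUpperGradient g u) (hfin : ∫⁻ x, g x ∂μ ≠ ⊤) :
    capacity1 μ {x | ¬ ApproxContinuousAt μ u x} = 0 := by
  let v : ℕ → X → ℝ := fun n x => max (-n) (min n (u x))
  have hv : ∀ n, IsUpperGradient g (v n) := fun n => by
    have := hg.comb isUpperGradient_zero 1 0 0 (f := v n) (by
      intro a b
      have h1 := abs_max_sub_max_le_abs (min (n : ℝ) (u a)) (min (n : ℝ) (u b)) (-n)
      have h2 := abs_min_sub_min_le_max (n : ℝ) (u a) n (u b)
      simp only [sub_self, abs_zero, abs_nonneg, sup_of_le_right] at h2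
      simp only [v]
      rw [max_comm (-(n : ℝ)), max_comm (-(n : ℝ))]
      simpa using h1.trans h2)
    simpa using this
  have hvM : ∀ n x, |v n x| ≤ (n : ℝ≥0) := fun n x => abs_le.2 ⟨le_max_left _ _,
    max_le (by have : (0:ℝ) ≤ n := n.cast_nonneg
               push_cast
               linarith) (min_le_left _ _)⟩
  refine le_antisymm ((capacity1_mono ?_).trans (capacity1_iUnion_eq_zero fun n =>
    hPI.capacity1_not_approxContinuousAt_of_bounded h hCd hCP hlam
      ((hu.const_inf (n : ℝ)).const_sup (-n : ℝ)) (hvM n) (hv n) hfin).le) (by positivity)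
  intro x hx
  by_contra hcon
  simp only [mem_iUnion, mem_ofPred_eq, not_exists, not_not] at hcon
  refine hx fun δ hδ => ?_
  obtain ⟨n, hn⟩ := exists_nat_ge (|u x| + δ)
  refine tendsto_of_tendsto_of_tendsto_of_le_of_le tendsto_const_nhds (hcon n δ hδ)
    (fun _ => by positivity) fun r => ?_
  refine ENNReal.div_le_div_right (measure_mono (inter_subset_inter_right _ fun y hy => ?_)) _
  have hy : δ ≤ |u y - u x| := hy
  have h1 := abs_le.1 (show |u x| ≤ n - δ by linarith)
  have h2 : v n x = u x := by
    simp only [v]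
    rw [min_eq_right (by linarith), max_eq_right (by linarith)]
  change δ ≤ |v n y - v n x|
  rw [h2]
  simp only [v]
  rcases le_total (n : ℝ) (u y) with h3 | h3
  · rw [min_eq_left h3, max_eq_right (by linarith)]
    exact le_trans (by linarith) (le_abs_self _)
  · rw [min_eq_right h3]
    rcases le_total (u y) (-n : ℝ) with h4 | h4
    · rw [max_eq_left h4, abs_sub_comm]
      exact le_trans (by linarith) (le_abs_self _)
    · rwa [max_eq_right h4]

end ApproximateContinuity

section Thinness

variable {μ : Measure X} {Cd : ℝ≥0} {CP lam : ℝ}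

/-- The relative capacity of a set on which `u` is far from its value at `y`. -/
lemma DoublingWith.relCapacity1_le [BorelSpace X] (h : DoublingWith μ Cd) {u : X → ℝ}
    {g : X → ℝ≥0∞} (hu : Measurable u) (hg : IsUpperGradient g u) (hfin : ∫⁻ x, g x ∂μ ≠ ⊤)
    {N A : Set X} (hN : capacity1 μ N = 0) {y : X} {δ r : ℝ} (hδ : 0 < δ) (hr : 0 < r)
    (hA : A ⊆ N ∪ {x | δ ≤ |u x - u y|}) :
    relCapacity1 μ (A ∩ ball y r) (ball y (2 * r)) ≤
      ENNReal.ofReal (2 / δ) * ∫⁻ x in ball y (2 * r), g x ∂μ +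
        ENNReal.ofReal (1 / r) * μ (ball y (2 * r) ∩ {x | δ / 4 ≤ |u x - u y|}) := by
  refine ENNReal_le_of_forall_le_add_mul (K := 2 + 4 * ENNReal.ofReal (1 / r))
    (by finiteness) fun η hη => ?_
  obtain ⟨η', hη'0, hη'⟩ := exists_between (show (0 : ℝ≥0∞) < min η 1 from lt_min hη one_pos)
  obtain ⟨z, gz, hz, hz0, hz1, hzN, hgz, hlt⟩ :=
    exists_of_capacity1_lt (μ := μ) (A := N) (c := η') (by rwa [hN])
  have hzη : ∫⁻ x, ENNReal.ofReal (z x) ∂μ ≤ η :=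
    le_self_add.trans (hlt.le.trans (hη'.le.trans (min_le_left _ _)))
  have hgzη : ∫⁻ x, gz x ∂μ ≤ η :=
    le_add_self.trans (hlt.le.trans (hη'.le.trans (min_le_left _ _)))
  have hgzfin : ∫⁻ x, gz x ∂μ ≠ ⊤ :=
    ne_top_of_le_ne_top ENNReal.one_ne_top
      (le_add_self.trans (hlt.le.trans (hη'.le.trans (min_le_right _ _))))
  set B := ball y (2 * r) with hB
  have hBfin : μ B < ⊤ := h.measure_ball_lt_top y (2 * r)
  set w : X → ℝ := fun x => |u x - u y| / δ + z x with hw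
  have hw0 : ∀ x, 0 ≤ |u x - u y| / δ := fun x => by positivity
  set f : X → ℝ := fun x => max 0 (min 1 (2 * w x - 1) + ballCutoff y r x - 1) with hf
  have hwm : Measurable w := ((hu.sub_const _).abs.div_const _).add hz
  have hfm : Measurable f :=
    (((((hwm.const_mul 2).sub_const 1).const_inf 1).add
      (measurable_ballCutoff y r)).sub_const 1).const_sup 0
  have hf0 : ∀ x, 0 ≤ f x := fun x => le_max_left _ _
  have hf1 : ∀ x, f x ≤ 1 := fun x => max_le zero_le_one (by
    have := ballCutoff_le_one y r x
    have := min_le_left 1 (2 * w x - 1)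
    linarith)
  have hfB : ∀ x, x ∉ B → f x = 0 := fun x hx => max_eq_left (by
    have := ballCutoff_eq_zero hr hx
    have := min_le_left 1 (2 * w x - 1)
    linarith)
  have hfA : ∀ x ∈ A ∩ ball y r, 1 ≤ f x := fun x hx => by
    have hw1 : 1 ≤ w x := by
      rcases hA hx.1 with hxN | hxu
      · have := hzN x hxN
        have := hw0 x
        simp only [hw]
        linarith
      · have h1 : 1 ≤ |u x - u y| / δ := (one_le_div hδ).2 hxu
        have := hz0 x
        simp only [hw]
        linarith
    refine le_max_of_le_right ?_
    rw [ballCutoff_eq_one hr hx.2, min_eq_left (by linarith)]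
    norm_num
  set Z : Set X := {x | f x ≠ 0} with hZ
  have hZm : MeasurableSet Z := (measurableSet_eq_fun hfm measurable_const).compl
  have hZsub : Z ⊆ (B ∩ {x | δ / 4 ≤ |u x - u y|}) ∪ {x | 1 / 4 ≤ ENNReal.ofReal (z x)} := by
    intro x hx
    have hxB : x ∈ B := by
      by_contra hxB
      exact hx (hfB x hxB)
    have hpos : 0 < min 1 (2 * w x - 1) + ballCutoff y r x - 1 := by
      by_contra hle
      exact hx (max_eq_left (not_lt.1 hle))
    have h1 := ballCutoff_le_one y r x
    have h2 := min_le_right 1 (2 * w x - 1)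
    have h3 : 1 / 2 < |u x - u y| / δ + z x := by
      change 1 / 2 < w x
      linarith
    rcases le_or_gt (1 / 4) (z x) with h4 | h4
    · right
      change 1 / 4 ≤ ENNReal.ofReal (z x)
      have : (1 / 4 : ℝ≥0∞) = ENNReal.ofReal (1 / 4) := by
        rw [ENNReal.ofReal_div_of_pos (by norm_num)]; simp
      rw [this]
      exact ENNReal.ofReal_le_ofReal h4
    · left
      refine ⟨hxB, ?_⟩
      have h5 : 1 / 4 ≤ |u x - u y| / δ := by linarith
      have h6 := (le_div_iff₀ hδ).1 h5
      change δ / 4 ≤ |u x - u y|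
      linarith
  have hmarkov : μ {x | 1 / 4 ≤ ENNReal.ofReal (z x)} ≤ 4 * η := by
    have := mul_meas_ge_le_lintegral (μ := μ) hz.ennreal_ofReal (1 / 4)
    calc μ {x | 1 / 4 ≤ ENNReal.ofReal (z x)}
        = 4 * (1 / 4 * μ {x | 1 / 4 ≤ ENNReal.ofReal (z x)}) := by
          rw [← mul_assoc, one_div, ENNReal.mul_inv_cancel (by norm_num) (by norm_num), one_mul]
      _ ≤ _ := by gcongr; exact this.trans hzη
  have hZμ : μ Z ≤ μ (B ∩ {x | δ / 4 ≤ |u x - u y|}) + 4 * η :=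
    (measure_mono hZsub).trans ((measure_union_le _ _).trans (by gcongr))
  have hk : IsUpperGradient (fun x => ((2 / δ).toNNReal : ℝ≥0∞) * g x + ((2 : ℝ≥0) : ℝ≥0∞) * gz x +
      ((1 / r).toNNReal : ℝ≥0)) f := by
    refine hg.comb hgz _ _ _ fun a b => ?_
    rw [Real.coe_toNNReal _ (by positivity), Real.coe_toNNReal _ (by positivity), NNReal.coe_ofNat]
    have e1 : |f a - f b| ≤ |(min 1 (2 * w a - 1) + ballCutoff y r a - 1) -
        (min 1 (2 * w b - 1) + ballCutoff y r b - 1)| := by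
      simp only [hf]
      rw [max_comm 0, max_comm 0]
      exact abs_max_sub_max_le_abs _ _ _
    have e2 : |min 1 (2 * w a - 1) - min 1 (2 * w b - 1)| ≤ |(2 * w a - 1) - (2 * w b - 1)| := by
      simpa using abs_min_sub_min_le_max 1 (2 * w a - 1) 1 (2 * w b - 1)
    have e3 : |(2 * w a - 1) - (2 * w b - 1)| ≤ 2 / δ * |u a - u b| + 2 * |z a - z b| := by
      have : (2 * w a - 1) - (2 * w b - 1) =
          2 / δ * (|u a - u y| - |u b - u y|) + 2 * (z a - z b) := by
        simp only [hw]; field_simp; ring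
      rw [this]
      refine (abs_add_le _ _).trans ?_
      rw [abs_mul, abs_mul, abs_of_pos (by positivity : 0 < 2 / δ), abs_two]
      have := abs_abs_sub_abs_le (u a - u y) (u b - u y)
      rw [sub_sub_sub_cancel_right] at this
      have := mul_le_mul_of_nonneg_left this (by positivity : 0 ≤ 2 / δ)
      linarith
    have e4 := abs_ballCutoff_sub_le y hr a b
    rw [inv_eq_one_div] at e4
    have e5 : (min 1 (2 * w a - 1) + ballCutoff y r a - 1) -
        (min 1 (2 * w b - 1) + ballCutoff y r b - 1) =
        (min 1 (2 * w a - 1) - min 1 (2 * w b - 1)) + (ballCutoff y r a - ballCutoff y r b) := by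
      ring
    rw [e5] at e1
    have := abs_add_le (min 1 (2 * w a - 1) - min 1 (2 * w b - 1))
      (ballCutoff y r a - ballCutoff y r b)
    linarith
  set k : X → ℝ≥0∞ := fun x => ((2 / δ).toNNReal : ℝ≥0∞) * g x + ((2 : ℝ≥0) : ℝ≥0∞) * gz x +
    Z.indicator (fun _ => ((1 / r).toNNReal : ℝ≥0∞)) x with hkdef
  have hkUG : IsUpperGradient k f := by
    refine hk.of_le_on_support (((hg.1.const_mul _).add (hgz.1.const_mul _)).add
      (measurable_const.indicator hZm)) 1 (1 / r).toNNReal (fun x => ?_) fun x hx => ?_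
    · rw [ENNReal.coe_one, one_mul, hkdef]
      gcongr
      exact le_self_add
    · simp only [hkdef]
      rw [indicator_of_mem (show x ∈ Z from hx)]
  have hkint : ∀ s : Set X, ∫⁻ x in s, k x ∂μ ≤ ENNReal.ofReal (2 / δ) * ∫⁻ x in s, g x ∂μ +
      2 * ∫⁻ x, gz x ∂μ + ENNReal.ofReal (1 / r) * μ Z := by
    intro s
    simp only [hkdef]
    rw [lintegral_add_right _ (measurable_const.indicator hZm),
      lintegral_add_left (hg.1.const_mul _), lintegral_const_mul _ hg.1,
      lintegral_const_mul _ hgz.1, lintegral_indicator_const hZm]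
    have h1 : ∫⁻ x in s, gz x ∂μ ≤ ∫⁻ x, gz x ∂μ := setLIntegral_le_lintegral _ _
    have h2 : μ.restrict s Z ≤ μ Z := Measure.restrict_apply_le _ _
    exact add_le_add (add_le_add le_rfl (mul_le_mul_right h1 _)) (mul_le_mul_right h2 _)
  have hZfin : μ Z < ⊤ := by
    refine (measure_mono fun x hx => ?_).trans_lt hBfin
    by_contra hxB
    exact hx (hfB x hxB)
  have hmem : MemN11 μ f := by
    refine ⟨hfm, (eN11Norm_le hkUG).trans_lt (ENNReal.add_lt_top.2 ⟨?_, ?_⟩)⟩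
    · calc ∫⁻ x, ENNReal.ofReal |f x| ∂μ ≤ ∫⁻ x, B.indicator (fun _ => 1) x ∂μ := by
            refine lintegral_mono fun x => ?_
            by_cases hx : x ∈ B
            · rw [indicator_of_mem hx, abs_of_nonneg (hf0 x)]
              simpa using hf1 x
            · simp [hfB x hx]
        _ = μ B := by rw [lintegral_indicator_const measurableSet_ball, one_mul]
        _ < ⊤ := hBfin
    · have := hkint univ
      rw [setLIntegral_univ, setLIntegral_univ] at this
      refine this.trans_lt ?_
      have := hZfin.ne
      finiteness
  calc relCapacity1 μ (A ∩ ball y r) B ≤ ∫⁻ x in B, k x ∂μ := by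
        refine iInf₂_le_of_le f hmem (iInf₂_le_of_le k hkUG (iInf₂_le_of_le hfA hfB le_rfl))
    _ ≤ _ := hkint B
    _ ≤ ENNReal.ofReal (2 / δ) * ∫⁻ x in B, g x ∂μ + 2 * η + ENNReal.ofReal (1 / r) *
          (μ (B ∩ {x | δ / 4 ≤ |u x - u y|}) + 4 * η) := by
        exact add_le_add (add_le_add le_rfl (mul_le_mul_right hgzη _)) (mul_le_mul_right hZμ _)
    _ = _ := by ring

lemma tendsto_two_mul_nhdsGT_zero : Tendsto (fun r : ℝ => 2 * r) (𝓝[>] 0) (𝓝[>] 0) := by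
  refine tendsto_nhdsWithin_iff.2 ⟨?_, ?_⟩
  · have : Tendsto (fun r : ℝ => 2 * r) (𝓝 0) (𝓝 (2 * 0)) := tendsto_id.const_mul 2
    rw [mul_zero] at this
    exact this.mono_left nhdsWithin_le_nhds
  · filter_upwards [self_mem_nhdsWithin] with r hr
    exact mem_Ioi.2 (_root_.mul_pos two_pos (mem_Ioi.1 hr))

/-- Thinness of the sets on which `u` is far from its value at a good point `y`. -/
lemma DoublingWith.oneThinAt [BorelSpace X] (h : DoublingWith μ Cd) {u : X → ℝ}
    {g : X → ℝ≥0∞} (hu : Measurable u) (hg : IsUpperGradient g u) (hfin : ∫⁻ x, g x ∂μ ≠ ⊤)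
    {N A : Set X} (hN : capacity1 μ N = 0) {y : X} {δ : ℝ} (hδ : 0 < δ)
    (hA : A ⊆ N ∪ {x | δ ≤ |u x - u y|}) (hyc : ApproxContinuousAt μ u y)
    (hyg : Tendsto (fun r : ℝ => ENNReal.ofReal r * (∫⁻ x in ball y r, g x ∂μ) / μ (ball y r))
      (𝓝[>] 0) (𝓝 0)) : OneThinAt μ A y := by
  have h1 := hyg.comp tendsto_two_mul_nhdsGT_zero
  have h2 := (hyc (δ / 4) (by positivity)).comp tendsto_two_mul_nhdsGT_zero
  have h3 : Tendsto (fun r : ℝ => (ENNReal.ofReal (2 / δ) * Cd) *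
      (ENNReal.ofReal (2 * r) * (∫⁻ x in ball y (2 * r), g x ∂μ) / μ (ball y (2 * r))) +
      Cd * (μ (ball y (2 * r) ∩ {x | δ / 4 ≤ |u x - u y|}) / μ (ball y (2 * r))))
      (𝓝[>] 0) (𝓝 0) := by
    have := (ENNReal.Tendsto.const_mul (a := ENNReal.ofReal (2 / δ) * Cd) h1
      (Or.inr (by finiteness))).add
      (ENNReal.Tendsto.const_mul (a := (Cd : ℝ≥0∞)) h2 (Or.inr (by finiteness)))
    simpa using this
  refine tendsto_of_tendsto_of_tendsto_of_le_of_le' tendsto_const_nhds h3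
    (Eventually.of_forall fun r => by positivity) ?_
  filter_upwards [self_mem_nhdsWithin] with r hr
  have hr : 0 < r := hr
  obtain ⟨hpos, hle, hlt⟩ := h y r hr
  obtain ⟨hpos2, -, hlt2⟩ := h y (2 * r) (by positivity)
  have hdiv : ∀ a : ℝ≥0∞, a / μ (ball y r) ≤ Cd * (a / μ (ball y (2 * r))) := by
    intro a
    rw [ENNReal.div_le_iff hpos.ne' hlt.ne]
    calc a = a / μ (ball y (2 * r)) * μ (ball y (2 * r)) :=
          (ENNReal.div_mul_cancel hpos2.ne' hlt2.ne).symm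
      _ ≤ a / μ (ball y (2 * r)) * (Cd * μ (ball y r)) := mul_le_mul_right hle _
      _ = _ := by ring
  have hR := h.relCapacity1_le hu hg hfin hN hδ hr hA
  refine (hdiv _).trans ?_
  set G := ∫⁻ x in ball y (2 * r), g x ∂μ
  set V := μ (ball y (2 * r) ∩ {x | δ / 4 ≤ |u x - u y|})
  have hrr : ENNReal.ofReal r * ENNReal.ofReal (1 / r) = 1 := by
    rw [← ENNReal.ofReal_mul hr.le, mul_one_div_cancel hr.ne', ENNReal.ofReal_one]
  calc (Cd : ℝ≥0∞) * (ENNReal.ofReal r * relCapacity1 μ (A ∩ ball y r) (ball y (2 * r)) /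
        μ (ball y (2 * r)))
      ≤ Cd * ((ENNReal.ofReal r * (ENNReal.ofReal (2 / δ) * G + ENNReal.ofReal (1 / r) * V)) /
        μ (ball y (2 * r))) :=
        mul_le_mul_right (ENNReal.div_le_div_right (mul_le_mul_right hR _) _) _
    _ = Cd * ((ENNReal.ofReal (2 / δ) * (ENNReal.ofReal r * G) + V) / μ (ball y (2 * r))) := by
        rw [mul_add, ← mul_assoc (ENNReal.ofReal r) (ENNReal.ofReal (1 / r)), hrr, one_mul]
        ring_nf
    _ ≤ Cd * ((ENNReal.ofReal (2 / δ) * (ENNReal.ofReal (2 * r) * G) + V) /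
        μ (ball y (2 * r))) := by
        refine mul_le_mul_right (ENNReal.div_le_div_right (add_le_add (mul_le_mul_right
          (mul_le_mul_left (ENNReal.ofReal_le_ofReal (by linarith)) _) _) le_rfl) _) _
    _ = _ := by
        simp only [div_eq_mul_inv]
        ring

end Thinness

/-- **Corollary (fine continuity of Newtonian functions).**
A function `u ∈ N^{1,1}(X)` is `1`-finely continuous at `1`-quasi every point. -/
theorem n11_fine_continuity
    {X : Type*} [MetricSpace X] [CompleteSpace X] [Nontrivial X]
    [MeasurableSpace X] [BorelSpace X] (μ : Measure X)
    (Cd : ℝ≥0) (hCd : 1 ≤ Cd) (hdbl : DoublingWith μ Cd)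
    (CP lam : ℝ) (hCP : 0 < CP) (hlam : 1 ≤ lam) (hPI : PoincareIneq μ CP lam)
    (u : X → ℝ) (hu : MemN11 μ u) :
    ∃ N : Set X, capacity1 μ N = 0 ∧
      ∀ x ∉ N, ∀ ε : ℝ, 0 < ε → ∃ U : Set X,
        OneFinelyOpen μ U ∧ x ∈ U ∧ ∀ y ∈ U, |u y - u x| < ε := by
  obtain ⟨g, hg, hlt⟩ := exists_of_eN11Norm_lt hu.2
  have hfin : ∫⁻ x, g x ∂μ ≠ ⊤ := (le_add_self.trans_lt hlt).ne
  set N₁ := {x | ¬ Tendsto (fun r : ℝ =>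
      ENNReal.ofReal r * (∫⁻ y in ball x r, g y ∂μ) / μ (ball x r)) (𝓝[>] 0) (𝓝 0)} with hN₁
  set N₂ := {x | ¬ ApproxContinuousAt μ u x} with hN₂
  have hN : capacity1 μ (N₁ ∪ N₂) = 0 := by
    refine le_antisymm ((capacity1_union_le _ _).trans ?_) (by positivity)
    rw [hN₁, hN₂, hdbl.capacity1_not_tendsto_gradient hg.1 hfin,
      hPI.capacity1_not_approxContinuousAt hdbl hCd hCP hlam hu.1 hg hfin, add_zero]
  refine ⟨N₁ ∪ N₂, hN, fun x hx ε hε => ⟨{y | y ∉ N₁ ∪ N₂ ∧ |u y - u x| < ε}, fun y hy => ?_,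
    ⟨hx, by simpa using hε⟩, fun y hy => hy.2⟩⟩
  obtain ⟨hyN, hyε⟩ := hy
  have hyg := not_not.1 fun hc => hyN (Or.inl hc)
  have hyc := not_not.1 fun hc => hyN (Or.inr hc)
  refine hdbl.oneThinAt hu.1 hg hfin hN (sub_pos.2 hyε) (fun z hz => ?_) hyc hyg
  by_cases hzN : z ∈ N₁ ∪ N₂
  · exact Or.inl hzN
  · right
    have h1 : ε ≤ |u z - u x| := by
      by_contra hlt
      exact hz ⟨hzN, not_le.1 hlt⟩
    have h2 := abs_sub_le (u z) (u y) (u x)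
    change ε - |u y - u x| ≤ |u z - u y|
    linarith

end FineBV
end
end

section
/- The collection of 1-finely open subsets of X is a topology on X: the empty set and X are 1-finely open, arbitrary unions of 1-finely open sets are 1-finely open, and finite intersections of 1-finely open sets are 1-finely open. -/
open MeasureTheory Metric Set Filter Topology ENNReal NNReal

noncomputable section

namespace FineBV

variable {X : Type*} [MetricSpace X] [MeasurableSpace X]

theorem IsUpperGradient.add {g h : X → ℝ≥0∞} {u v : X → ℝ}
    (hg : IsUpperGradient g u) (hh : IsUpperGradient h v) :
    IsUpperGradient (g + h) (u + v) := by
  refine ⟨hg.1.add hh.1, fun ℓ hℓ γ hγ hmem => ?_⟩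
  have key : |(u + v) (γ ℓ) - (u + v) (γ 0)| ≤ |u (γ ℓ) - u (γ 0)| + |v (γ ℓ) - v (γ 0)| := by
    simpa only [Pi.add_apply, add_sub_add_comm] using abs_add_le _ _
  calc ENNReal.ofReal |(u + v) (γ ℓ) - (u + v) (γ 0)|
      ≤ ENNReal.ofReal |u (γ ℓ) - u (γ 0)| + ENNReal.ofReal |v (γ ℓ) - v (γ 0)| :=
        (ENNReal.ofReal_le_ofReal key).trans ENNReal.ofReal_add_le
    _ ≤ (∫⁻ t in Icc (0:ℝ) ℓ, g (γ t)) + ∫⁻ t in Icc (0:ℝ) ℓ, h (γ t) :=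
        add_le_add (hg.2 ℓ hℓ γ hγ hmem) (hh.2 ℓ hℓ γ hγ hmem)
    _ ≤ ∫⁻ t in Icc (0:ℝ) ℓ, (g + h) (γ t) := le_lintegral_add _ _

theorem isUpperGradient_zero_s2 : IsUpperGradient (0 : X → ℝ≥0∞) (0 : X → ℝ) :=
  ⟨measurable_zero, fun ℓ _ γ _ _ => by simp⟩

theorem eL1Norm_add_le {Y : Type*} [MeasurableSpace Y] (μ : Measure Y) {u v : Y → ℝ} (hu : Measurable u) :
    eL1Norm μ (u + v) ≤ eL1Norm μ u + eL1Norm μ v := by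
  unfold eL1Norm
  rw [← lintegral_add_left (by fun_prop)]
  exact lintegral_mono fun x =>
    (ENNReal.ofReal_le_ofReal (abs_add_le _ _)).trans ENNReal.ofReal_add_le

theorem eN11Norm_add_le (μ : Measure X) {u v : X → ℝ} (hu : Measurable u) :
    eN11Norm μ (u + v) ≤ eN11Norm μ u + eN11Norm μ v := by
  unfold eN11Norm
  rw [add_add_add_comm]
  refine add_le_add (eL1Norm_add_le μ hu) ?_
  simp only [ENNReal.iInf_add, ENNReal.add_iInf]
  exact le_iInf₂ fun h hh => le_iInf₂ fun g hg =>
    (iInf₂_le (g + h) (hg.add hh)).trans (lintegral_add_left hg.1 h).le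

theorem MemN11.add {μ : Measure X} {u v : X → ℝ} (hu : MemN11 μ u) (hv : MemN11 μ v) :
    MemN11 μ (u + v) :=
  ⟨hu.1.add hv.1, (eN11Norm_add_le μ hu.1).trans_lt (ENNReal.add_lt_top.2 ⟨hu.2, hv.2⟩)⟩

theorem memN11_zero (μ : Measure X) : MemN11 μ (0 : X → ℝ) := by
  refine ⟨measurable_zero, ?_⟩
  have h : (⨅ (g : X → ℝ≥0∞) (_ : IsUpperGradient g (0 : X → ℝ)), ∫⁻ x, g x ∂μ) ≤ 0 :=
    (iInf₂_le (0 : X → ℝ≥0∞) isUpperGradient_zero_s2).trans_eq lintegral_zero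
  simp [eN11Norm, eL1Norm, le_antisymm h bot_le]

theorem relCapacity1_le {μ : Measure X} {A Ω : Set X} {u : X → ℝ} {g : X → ℝ≥0∞}
    (hu : MemN11 μ u) (hg : IsUpperGradient g u) (hA : ∀ x ∈ A, 1 ≤ u x)
    (hΩ : ∀ x, x ∉ Ω → u x = 0) : relCapacity1 μ A Ω ≤ ∫⁻ x in Ω, g x ∂μ :=
  iInf₂_le_of_le u hu <| iInf₂_le_of_le g hg <| iInf₂_le hA hΩ

theorem relCapacity1_empty (μ : Measure X) (Ω : Set X) : relCapacity1 μ ∅ Ω = 0 :=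
  le_antisymm ((relCapacity1_le (memN11_zero μ) isUpperGradient_zero_s2 (by simp) (by simp)).trans
    (by simp)) bot_le

theorem relCapacity1_mono (μ : Measure X) {A B : Set X} (h : A ⊆ B) (Ω : Set X) :
    relCapacity1 μ A Ω ≤ relCapacity1 μ B Ω :=
  le_iInf₂ fun _ hu => le_iInf₂ fun _ hg => le_iInf₂ fun hB hΩ =>
    relCapacity1_le hu hg (fun x hx => hB x (h hx)) hΩ

/-- An upper gradient of `u` is an upper gradient of the positive part of `u`. -/
theorem IsUpperGradient.posPart {g : X → ℝ≥0∞} {u : X → ℝ} (hg : IsUpperGradient g u) :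
    IsUpperGradient g (fun x => max (u x) 0) :=
  ⟨hg.1, fun ℓ hℓ γ hγ hmem =>
    (ENNReal.ofReal_le_ofReal (abs_max_sub_max_le_abs _ _ _)).trans (hg.2 ℓ hℓ γ hγ hmem)⟩

theorem MemN11.posPart {μ : Measure X} {u : X → ℝ} (hu : MemN11 μ u) :
    MemN11 μ (fun x => max (u x) 0) := by
  refine ⟨hu.1.max measurable_const, lt_of_le_of_lt ?_ hu.2⟩
  refine add_le_add (lintegral_mono fun x => ENNReal.ofReal_le_ofReal ?_)
    (le_iInf₂ fun g hg => iInf₂_le g hg.posPart)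
  simpa using abs_max_sub_max_le_abs (u x) 0 0

theorem relCapacity1_union_le (μ : Measure X) (A B Ω : Set X) :
    relCapacity1 μ (A ∪ B) Ω ≤ relCapacity1 μ A Ω + relCapacity1 μ B Ω := by
  conv_rhs => unfold relCapacity1
  simp only [ENNReal.iInf_add]
  refine le_iInf₂ fun u hu => le_iInf₂ fun g hg => le_iInf₂ fun hA hΩ => ?_
  simp only [ENNReal.add_iInf]
  refine le_iInf₂ fun v hv => le_iInf₂ fun h hh => le_iInf₂ fun hB hΩ' => ?_
  rw [← lintegral_add_left hg.1]
  refine relCapacity1_le (hu.posPart.add hv.posPart) (hg.posPart.add hh.posPart) ?_ ?_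
  · rintro x (hx | hx)
    · exact le_add_of_le_of_nonneg (le_max_of_le_left (hA x hx)) (le_max_right _ _)
    · exact le_add_of_nonneg_of_le (le_max_right _ _) (le_max_of_le_left (hB x hx))
  · intro x hx
    simp [hΩ x hx, hΩ' x hx]

theorem oneThinAt_empty (μ : Measure X) (x : X) : OneThinAt μ ∅ x := by
  simp [OneThinAt, relCapacity1_empty]

theorem OneThinAt.mono {μ : Measure X} {A B : Set X} {x : X} (hB : OneThinAt μ B x)
    (h : A ⊆ B) : OneThinAt μ A x :=
  tendsto_of_tendsto_of_tendsto_of_le_of_le tendsto_const_nhds hB (fun _ => bot_le) fun _ =>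
    ENNReal.div_le_div_right
      (mul_le_mul_right (relCapacity1_mono μ (inter_subset_inter_left _ h) _) _) _

theorem OneThinAt.union {μ : Measure X} {A B : Set X} {x : X} (hA : OneThinAt μ A x)
    (hB : OneThinAt μ B x) : OneThinAt μ (A ∪ B) x := by
  have hsum := Tendsto.add hA hB
  rw [add_zero] at hsum
  refine tendsto_of_tendsto_of_tendsto_of_le_of_le tendsto_const_nhds hsum
    (fun _ => bot_le) fun r => ?_
  rw [← ENNReal.add_div, ← mul_add, union_inter_distrib_right]
  exact ENNReal.div_le_div_right (mul_le_mul_right (relCapacity1_union_le μ _ _ _) _) _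

/-- **Lemma.** The collection of `1`-finely open sets is a topology on `X`:
`∅` and `X` are `1`-finely open, arbitrary unions of `1`-finely open sets are
`1`-finely open, and finite (here: binary) intersections of `1`-finely open sets
are `1`-finely open. -/
theorem oneFinelyOpen_isTopology
    {X : Type*} [MetricSpace X] [CompleteSpace X] [Nontrivial X]
    [MeasurableSpace X] [BorelSpace X] (μ : Measure X)
    (Cd : ℝ≥0) (hCd : 1 ≤ Cd) (hdbl : DoublingWith μ Cd) :
    OneFinelyOpen μ (∅ : Set X) ∧
    OneFinelyOpen μ (univ : Set X) ∧
    (∀ S : Set (Set X), (∀ U ∈ S, OneFinelyOpen μ U) → OneFinelyOpen μ (⋃₀ S)) ∧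
    (∀ U V : Set X, OneFinelyOpen μ U → OneFinelyOpen μ V → OneFinelyOpen μ (U ∩ V)) := by
  refine ⟨fun x hx => hx.elim, fun x _ => ?_, fun S hS x hx => ?_, fun U V hU hV x hx => ?_⟩
  · rw [compl_univ]
    exact oneThinAt_empty μ x
  · obtain ⟨U, hUS, hxU⟩ := hx
    exact (hS U hUS x hxU).mono (compl_subset_compl.2 (subset_sUnion_of_mem hUS))
  · rw [compl_inter]
    exact (hU x hx.1).union (hV x hx.2)

end FineBV
end
end
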